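/- Let I be a Cohen-Macaulay R-ideal of positive grade and let x_1,...,x_r ∈ R be a sequence that is regular on R and on R/I. If I is maximal in its linkage class, then the ideal I + (x_1,...,x_r) is maximal in its linkage class. -/

import Mathlib

open RingTheory IsLocalRing

/-- A proper ideal generated by a regular sequence is a complete intersection. -/
def IsCompleteIntersectionIdeal (R : Type) [CommRing R] (I : Ideal R) : Prop :=
  I ≠ ⊤ ∧ ∃ rs : List R, RingTheory.Sequence.IsRegular R rs ∧ Ideal.ofList rs = I

/-- Two proper ideals are directly linked if there is a complete intersection
`c ⊆ I ⊓ J` with `I = c : J` and `J = c : I`. -/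
def IsDirectlyLinked (R : Type) [CommRing R] (I J : Ideal R) : Prop :=
  I ≠ ⊤ ∧ J ≠ ⊤ ∧ ∃ c : Ideal R, IsCompleteIntersectionIdeal R c ∧ c ≤ I ⊓ J ∧
    Submodule.colon c J = I ∧ Submodule.colon c I = J

/-- The linkage (liaison) equivalence: the equivalence relation generated by direct linkage. -/
def InSameLinkageClass (R : Type) [CommRing R] (I J : Ideal R) : Prop :=
  Relation.EqvGen (IsDirectlyLinked R) I J

/-- An ideal is licci if its linkage class contains a complete intersection. -/
def Licci (R : Type) [CommRing R] (I : Ideal R) : Prop :=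
  ∃ J, InSameLinkageClass R I J ∧ IsCompleteIntersectionIdeal R J

open Classical in
/-- `∫ I` : the sum of all ideals in the linkage class of `I` if `I` is not licci,
and the unit ideal otherwise. -/
noncomputable def intLink (R : Type) [CommRing R] (I : Ideal R) : Ideal R :=
  if Licci R I then ⊤ else sSup {J : Ideal R | InSameLinkageClass R I J}

/-- An ideal is maximal in its linkage class if it contains every ideal in its linkage class. -/
def MaximalInLinkageClass (R : Type) [CommRing R] (I : Ideal R) : Prop :=
  ∀ J, InSameLinkageClass R I J → J ≤ I

/-- Linked in `n` steps. -/
def LinkedInSteps (R : Type) [CommRing R] : ℕ → Ideal R → Ideal R → Prop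
  | 0, I, J => I = J
  | (n+1), I, J => ∃ K, IsDirectlyLinked R I K ∧ LinkedInSteps R n K J

/-- The grade of an ideal: the supremum of lengths of regular sequences contained in it. -/
noncomputable def gradeOf (R : Type) [CommRing R] (I : Ideal R) : ℕ :=
  sSup {n : ℕ | ∃ rs : List R, rs.length = n ∧ (∀ r ∈ rs, r ∈ I) ∧
    RingTheory.Sequence.IsRegular R rs}

/-- A Noetherian local ring is Cohen-Macaulay if its depth (the grade of its maximal ideal)
equals its Krull dimension. -/
def IsCMLocalRing (A : Type) [CommRing A] [IsLocalRing A] : Prop :=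
  ringKrullDim A = (gradeOf A (maximalIdeal A) : WithBot (WithTop ℕ))

/-- An ideal `I` of `R` is a Cohen-Macaulay ideal if `R/I` is a Cohen-Macaulay local ring. -/
def IsCMIdeal (R : Type) [CommRing R] (I : Ideal R) : Prop :=
  ∃ h : IsLocalRing (R ⧸ I), @IsCMLocalRing (R ⧸ I) _ h

/-- A Noetherian local ring is Gorenstein if it is Cohen-Macaulay and some ideal generated
by a regular sequence and primary to the maximal ideal is irreducible. -/
def IsGorensteinLocalRing (A : Type) [CommRing A] [IsLocalRing A] : Prop :=
  IsCMLocalRing A ∧ ∃ rs : List A, RingTheory.Sequence.IsRegular A rs ∧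
    (Ideal.ofList rs).radical = maximalIdeal A ∧ InfIrred (Ideal.ofList rs)

namespace Linkage

open Ideal RingTheory.Sequence IsLocalRing

section

variable {R : Type*} [CommRing R]

/-- `a` is a nonzerodivisor modulo `K`. -/
def RegOn (K : Ideal R) (a : R) : Prop := ∀ r, a * r ∈ K → r ∈ K

/-- The list is a weakly regular sequence on `R ⧸ K`. -/
def RegSeq : Ideal R → List R → Prop
  | _, [] => True
  | K, a :: l => RegOn K a ∧ RegSeq (K ⊔ span {a}) l

lemma mem_colon_ideal {c K : Ideal R} {r : R} :
    r ∈ Submodule.colon c (K : Set R) ↔ ∀ s ∈ K, r * s ∈ c := by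
  simp [Submodule.mem_colon]

lemma RegOn.isSMulRegular_iff {K : Ideal R} {a : R} :
    IsSMulRegular (R ⧸ K) a ↔ RegOn K a := by
  rw [isSMulRegular_quotient_iff_mem_of_smul_mem]
  rfl

lemma regSeq_append (K : Ideal R) (l l' : List R) :
    RegSeq K (l ++ l') ↔ RegSeq K l ∧ RegSeq (K ⊔ ofList l) l' := by
  induction l generalizing K with
  | nil => simp [RegSeq]
  | cons a l ih => simp [RegSeq, ih, and_assoc, ofList_cons, sup_assoc]

/-- Reducing `R ⧸ K` modulo `a`. -/
noncomputable def quotSMulTopEquiv (K : Ideal R) (a : R) :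
    QuotSMulTop a (R ⧸ K) ≃ₗ[R] R ⧸ (K ⊔ span {a}) :=
  (Submodule.quotEquivOfEq _ _ (by
    rw [← Submodule.ideal_span_singleton_smul, ← Submodule.range_mkQ K, ← Submodule.map_top,
      ← Submodule.map_smul'', smul_eq_mul, mul_top])).trans
    (Submodule.quotientQuotientEquivQuotientSup K (span {a}))

lemma regSeq_iff_isWeaklyRegular (K : Ideal R) (l : List R) :
    RegSeq K l ↔ IsWeaklyRegular (R ⧸ K) l := by
  induction l generalizing K with
  | nil => simp [RegSeq]
  | cons a l ih =>
    rw [isWeaklyRegular_cons_iff, RegOn.isSMulRegular_iff, RegSeq, ih,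
      (quotSMulTopEquiv K a).isWeaklyRegular_congr]

lemma isRegular_quotient_iff (K : Ideal R) (l : List R) :
    IsRegular (R ⧸ K) l ↔ RegSeq K l ∧ K ⊔ ofList l ≠ ⊤ := by
  rw [isRegular_iff, regSeq_iff_isWeaklyRegular]
  refine and_congr_right fun _ => not_congr ?_
  rw [← Submodule.range_mkQ K, ← Submodule.map_top, ← Submodule.map_smul'', smul_eq_mul, mul_top]
  constructor
  · intro h
    have := congrArg (Submodule.comap K.mkQ) h
    rw [Submodule.comap_map_mkQ, Submodule.comap_map_mkQ] at this
    rw [← this]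
    simp
  · intro h
    have := congrArg (Submodule.map K.mkQ) h
    rw [Submodule.map_sup, Submodule.mkQ_map_self, bot_sup_eq] at this
    exact this.symm

lemma isRegular_iff_regSeq (l : List R) :
    IsRegular R l ↔ RegSeq ⊥ l ∧ ofList l ≠ ⊤ := by
  rw [← (Submodule.quotEquivOfEqBot (⊥ : Ideal R) rfl).isRegular_congr, isRegular_quotient_iff,
    bot_sup_eq]

lemma ofList_le {l : List R} {K : Ideal R} : ofList l ≤ K ↔ ∀ a ∈ l, a ∈ K :=
  span_le

lemma mem_ofList {l : List R} {a : R} (h : a ∈ l) : a ∈ ofList l := subset_span h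

lemma RegSeq.perm [IsLocalRing R] [IsNoetherianRing R] {K : Ideal R} {l l' : List R}
    (h : RegSeq K l) (hp : l.Perm l') (hm : ∀ a ∈ l, a ∈ maximalIdeal R) : RegSeq K l' := by
  rw [regSeq_iff_isWeaklyRegular] at h ⊢
  exact IsLocalRing.isWeaklyRegular_of_perm_of_subset_maximalIdeal h hp hm

/-- The last element of a regular sequence may be moved to the front. -/
lemma RegSeq.rotate [IsLocalRing R] [IsNoetherianRing R] {K : Ideal R} {l : List R} {u : R}
    (h : RegSeq K l) (hu : RegOn (K ⊔ ofList l) u) (hl : ∀ a ∈ l, a ∈ maximalIdeal R)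
    (hum : u ∈ maximalIdeal R) : RegOn K u ∧ RegSeq (K ⊔ span {u}) l :=
  RegSeq.perm (l' := u :: l) ((regSeq_append K l [u]).2 ⟨h, hu, trivial⟩)
    (List.perm_append_singleton u l) (by
      simpa only [List.mem_append, List.mem_singleton, or_imp, forall_and, forall_eq]
        using ⟨hl, hum⟩)

lemma RegOn.congr {K : Ideal R} {a b : R} (h : RegOn K a) (hab : a - b ∈ K) : RegOn K b := by
  intro r hr
  refine h r ?_
  have := K.add_mem hr (K.mul_mem_right r hab)
  ring_nf at this ⊢
  exact this

lemma RegOn.of_mul_unit {K : Ideal R} {a u : R} (h : RegOn K (u * a)) : RegOn K a :=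
  fun r hr => h r (by rw [mul_assoc]; exact K.mul_mem_left _ hr)

lemma RegOn.mul {K : Ideal R} {a b : R} (ha : RegOn K a) (hb : RegOn K b) : RegOn K (a * b) :=
  fun r hr => hb r (ha _ (by rwa [← mul_assoc]))

lemma RegOn.pow {K : Ideal R} {a : R} (ha : RegOn K a) (n : ℕ) : RegOn K (a ^ n) := by
  induction n with
  | zero => intro r; simp
  | succ n ih => rw [pow_succ]; exact ih.mul ha

/-- Nonzerodivisors modulo `c` stay so modulo a colon ideal of `c`. -/
lemma RegOn.colon {c : Ideal R} {a : R} (h : RegOn c a) (K : Ideal R) :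
    RegOn (Submodule.colon c (K : Set R)) a := by
  intro r hr
  rw [mem_colon_ideal] at hr ⊢
  intro s hs
  exact h _ (by rw [← mul_assoc]; exact hr s hs)

lemma mem_sup_span_iff {K : Ideal R} {a x : R} : x ∈ K ⊔ span {a} ↔ ∃ t, x - a * t ∈ K := by
  simp only [Submodule.mem_sup, mem_span_singleton']
  constructor
  · rintro ⟨k, hk, _, ⟨b, rfl⟩, rfl⟩
    exact ⟨b, by rwa [mul_comm, add_sub_cancel_right]⟩
  · rintro ⟨t, ht⟩
    exact ⟨_, ht, _, ⟨t, rfl⟩, by ring⟩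

lemma sup_span_singleton_congr {K : Ideal R} {a b : R} (h : a - b ∈ K) :
    K ⊔ span {a} = K ⊔ span {b} := by
  apply le_antisymm <;> refine sup_le le_sup_left ((span_singleton_le_iff_mem _).2 ?_)
  · rw [show a = (a - b) + b by ring]
    exact add_mem (mem_sup_left h) (mem_sup_right (mem_span_singleton_self b))
  · rw [show b = -(a - b) + a by ring]
    exact add_mem (mem_sup_left (neg_mem h)) (mem_sup_right (mem_span_singleton_self a))

lemma sup_ofList_congr {K : Ideal R} {l l' : List R}
    (h : List.Forall₂ (fun a b => a - b ∈ K) l l') : K ⊔ ofList l = K ⊔ ofList l' := by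
  induction h with
  | nil => rfl
  | cons hab _ ih =>
    rw [ofList_cons, ofList_cons, ← sup_assoc, ← sup_assoc, sup_span_singleton_congr hab,
      sup_right_comm, ih, sup_right_comm]

lemma RegSeq.congr {K : Ideal R} {l l' : List R}
    (h : List.Forall₂ (fun a b => a - b ∈ K) l l') (hl : RegSeq K l) : RegSeq K l' := by
  induction l generalizing K l' with
  | nil => cases h; trivial
  | cons a l ih =>
    obtain _ | ⟨hab, h'⟩ := h
    refine ⟨hl.1.congr hab, ?_⟩
    rw [← sup_span_singleton_congr hab]
    exact ih (h'.imp fun _ _ h => mem_sup_left h) hl.2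

lemma regOn_comap_iff {A : Type*} [CommRing A] {ψ : A →+* R} (hψ : Function.Surjective ψ)
    (K : Ideal R) (a : A) : RegOn (K.comap ψ) a ↔ RegOn K (ψ a) := by
  simp only [RegOn, mem_comap, map_mul]
  exact ⟨fun h r => by obtain ⟨r, rfl⟩ := hψ r; exact h r, fun h r => h _⟩

lemma comap_sup_span {A : Type*} [CommRing A] {ψ : A →+* R} (hψ : Function.Surjective ψ)
    (K : Ideal R) (a : A) : (K ⊔ span {ψ a}).comap ψ = K.comap ψ ⊔ span {a} := by
  ext x
  simp only [mem_comap, Submodule.mem_sup, mem_span_singleton']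
  constructor
  · rintro ⟨k, hk, _, ⟨b, rfl⟩, h⟩
    obtain ⟨b, rfl⟩ := hψ b
    exact ⟨x - b * a, by rwa [map_sub, map_mul, ← h, add_sub_cancel_right], _, ⟨b, rfl⟩, by ring⟩
  · rintro ⟨k, hk, _, ⟨b, rfl⟩, rfl⟩
    exact ⟨ψ k, hk, _, ⟨ψ b, rfl⟩, by simp⟩

lemma regSeq_comap_iff {A : Type*} [CommRing A] {ψ : A →+* R} (hψ : Function.Surjective ψ)
    (K : Ideal R) (l : List A) : RegSeq (K.comap ψ) l ↔ RegSeq K (l.map ψ) := by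
  induction l generalizing K with
  | nil => simp [RegSeq]
  | cons a l ih =>
    rw [List.map_cons, RegSeq, RegSeq, regOn_comap_iff hψ, ← ih, comap_sup_span hψ]

lemma biUnion_associatedPrimes [IsNoetherianRing R] (K : Ideal R) (a : R) :
    a ∈ ⋃ p ∈ associatedPrimes R (R ⧸ K), (p : Set R) ↔ ¬ RegOn K a := by
  rw [biUnion_associatedPrimes_eq_compl_regular]
  exact not_congr RegOn.isSMulRegular_iff

/-- Prime avoidance for nonzerodivisors modulo finitely many ideals; the ideal `L` need not
be prime. -/
lemma exists_regOn_notMem [IsNoetherianRing R] (J L : Ideal R) (Ks : List (Ideal R))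
    (h : ∀ K ∈ Ks, ∃ a ∈ J, RegOn K a) (hL : ¬ J ≤ L) :
    ∃ a ∈ J, a ∉ L ∧ ∀ K ∈ Ks, RegOn K a := by
  by_contra! H
  let s : Set (Ideal R) := insert L (⋃ K ∈ {K | K ∈ Ks}, associatedPrimes R (R ⧸ K))
  have hs : s.Finite := ((List.finite_toSet Ks).biUnion fun K _ =>
    associatedPrimes.finite R (R ⧸ K)).insert L
  have hsub : (J : Set R) ⊆ ⋃ p ∈ s, ((id p : Ideal R) : Set R) := by
    intro a ha
    by_cases haL : a ∈ L
    · exact Set.mem_biUnion (Set.mem_insert _ _) haL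
    · obtain ⟨K, hK, hKa⟩ := H a ha haL
      rw [← biUnion_associatedPrimes] at hKa
      obtain ⟨p, hp, hap⟩ := Set.mem_iUnion₂.1 hKa
      exact Set.mem_biUnion (Set.mem_insert_of_mem _ (Set.mem_biUnion hK hp)) hap
  rw [subset_union_prime_finite hs L L] at hsub
  · obtain ⟨p, hp, hJp⟩ := hsub
    rcases hp with rfl | hp
    · exact hL hJp
    · obtain ⟨K, hK, hp⟩ := Set.mem_iUnion₂.1 hp
      obtain ⟨a, ha, hKa⟩ := h K hK
      exact (biUnion_associatedPrimes K a).1 (Set.mem_biUnion hp (hJp ha)) hKa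
  · rintro p hp hpL -
    rcases hp with rfl | hp
    · exact absurd rfl hpL
    · obtain ⟨K, -, hp⟩ := Set.mem_iUnion₂.1 hp
      exact hp.isPrime

lemma exists_regOn [IsNoetherianRing R] (J : Ideal R) (Ks : List (Ideal R))
    (h : ∀ K ∈ Ks, ∃ a ∈ J, RegOn K a) : ∃ a ∈ J, ∀ K ∈ Ks, RegOn K a := by
  by_cases hJ : J ≤ ⊥
  · rcases Ks with _ | ⟨K, Ks⟩
    · exact ⟨0, J.zero_mem, by simp⟩
    · refine ⟨0, J.zero_mem, fun K hK => ?_⟩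
      obtain ⟨a, ha, hKa⟩ := h K hK
      rwa [← (Submodule.mem_bot R).1 (hJ ha)]
  · obtain ⟨a, ha, -, h⟩ := exists_regOn_notMem J ⊥ Ks h hJ
    exact ⟨a, ha, h⟩

lemma le_colon {c K : Ideal R} : c ≤ Submodule.colon c (K : Set R) := fun x hx => by
  rw [mem_colon_ideal]
  exact fun s _ => c.mul_mem_right s hx

lemma colon_anti {c K L : Ideal R} (h : K ≤ L) :
    Submodule.colon c (L : Set R) ≤ Submodule.colon c (K : Set R) := fun x hx => by
  rw [mem_colon_ideal] at hx ⊢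
  exact fun s hs => hx s (h hs)

lemma le_colon_colon {c K : Ideal R} :
    K ≤ Submodule.colon c (Submodule.colon c (K : Set R) : Set R) := fun x hx => by
  rw [mem_colon_ideal]
  intro s hs
  rw [mul_comm]
  exact mem_colon_ideal.1 hs x hx

lemma mem_colon_sup_span {c K : Ideal R} {x b : R} :
    b ∈ Submodule.colon c ((K ⊔ span {x} : Ideal R) : Set R) ↔
      b ∈ Submodule.colon c (K : Set R) ∧ b * x ∈ c := by
  simp only [mem_colon_ideal]
  constructor
  · exact fun h => ⟨fun s hs => h s (mem_sup_left hs),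
      h x (mem_sup_right (mem_span_singleton_self x))⟩
  · rintro ⟨h, hx⟩ s hs
    obtain ⟨t, ht⟩ := mem_sup_span_iff.1 hs
    convert c.add_mem (h _ ht) (c.mul_mem_right t hx) using 1
    ring

lemma colon_top {q : Ideal R} : Submodule.colon q ((⊤ : Ideal R) : Set R) = q :=
  le_antisymm (fun x hx => by simpa using mem_colon_ideal.1 hx 1 trivial) le_colon

lemma colon_self {q : Ideal R} : Submodule.colon q (q : Set R) = ⊤ :=
  eq_top_iff.2 fun x _ => mem_colon_ideal.2 fun _ hs => q.mul_mem_left x hs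

end

section

variable {R : Type*} [CommRing R] [IsLocalRing R]

/-- `R ⧸ q` has a nonzero socle. -/
def HasSocle (q : Ideal R) : Prop := ∃ w ∉ q, ∀ a ∈ maximalIdeal R, a * w ∈ q

/-- The socle of `R ⧸ q` is one-dimensional. -/
def HasSimpleSocle (q : Ideal R) : Prop :=
  ∃ w ∉ q, (∀ a ∈ maximalIdeal R, a * w ∈ q) ∧
    ∀ v, (∀ a ∈ maximalIdeal R, a * v ∈ q) → ∃ r, v - r * w ∈ q

lemma exchange_socle {K : Ideal R} {y z : R} (hy : RegOn K y) (hz : RegOn K z)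
    (hzm : z ∈ maximalIdeal R) {w : R} (hw : ∀ a ∈ maximalIdeal R, a * w ∈ K ⊔ span {y}) :
    ∃ v, z * w - y * v ∈ K ∧ (∀ a ∈ maximalIdeal R, a * v ∈ K ⊔ span {z}) ∧
      (v ∈ K ⊔ span {z} → w ∈ K ⊔ span {y}) := by
  obtain ⟨v, hv⟩ := mem_sup_span_iff.1 (hw z hzm)
  refine ⟨v, hv, fun a ha => ?_, fun h => ?_⟩
  · obtain ⟨t, ht⟩ := mem_sup_span_iff.1 (hw a ha)
    refine mem_sup_span_iff.2 ⟨t, hy _ ?_⟩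
    have := K.sub_mem (K.mul_mem_left z ht) (K.mul_mem_left a hv)
    ring_nf at this ⊢
    exact this
  · obtain ⟨t, ht⟩ := mem_sup_span_iff.1 h
    refine mem_sup_span_iff.2 ⟨t, hz _ ?_⟩
    have := K.add_mem (K.mul_mem_left y ht) hv
    ring_nf at this ⊢
    exact this

lemma HasSocle.exchange {K : Ideal R} {y z : R} (hy : RegOn K y) (hz : RegOn K z)
    (hzm : z ∈ maximalIdeal R) (h : HasSocle (K ⊔ span {y})) : HasSocle (K ⊔ span {z}) := by
  obtain ⟨w, hw, hmw⟩ := h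
  obtain ⟨v, -, hmv, hv⟩ := exchange_socle hy hz hzm hmw
  exact ⟨v, fun h => hw (hv h), hmv⟩

lemma HasSimpleSocle.exchange {K : Ideal R} {y z : R} (hy : RegOn K y) (hz : RegOn K z)
    (hym : y ∈ maximalIdeal R) (hzm : z ∈ maximalIdeal R)
    (h : HasSimpleSocle (K ⊔ span {y})) : HasSimpleSocle (K ⊔ span {z}) := by
  obtain ⟨w, hw, hmw, hsoc⟩ := h
  obtain ⟨v, hvw, hmv, hv⟩ := exchange_socle hy hz hzm hmw
  refine ⟨v, fun h => hw (hv h), hmv, fun v' hv' => ?_⟩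
  obtain ⟨w', hvw', hmw', -⟩ := exchange_socle hz hy hym hv'
  obtain ⟨r, hr⟩ := hsoc w' hmw'
  obtain ⟨t, ht⟩ := mem_sup_span_iff.1 hr
  refine ⟨r, mem_sup_span_iff.2 ⟨t, hy _ ?_⟩⟩
  have := K.add_mem (K.add_mem hvw' (K.mul_mem_left z ht)) (K.mul_mem_left r hvw)
  ring_nf at this ⊢
  exact this

lemma HasSimpleSocle.of_regSeq [IsNoetherianRing R] (n : ℕ) {K : Ideal R}
    {ys zs : List R} (hys : RegSeq K ys)
    (hzs : RegSeq K zs) (hym : ∀ a ∈ ys, a ∈ maximalIdeal R)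
    (hzm : ∀ a ∈ zs, a ∈ maximalIdeal R) (hyn : ys.length = n) (hzn : zs.length = n)
    (h : HasSimpleSocle (K ⊔ ofList ys)) : HasSimpleSocle (K ⊔ ofList zs) := by
  induction n generalizing K ys zs with
  | zero =>
    rw [List.length_eq_zero_iff] at hyn hzn
    rwa [hzn, ← hyn]
  | succ n ih =>
    obtain rfl | ⟨ys, y, rfl⟩ := List.eq_nil_or_concat' ys
    · simp at hyn
    obtain rfl | ⟨zs, z, rfl⟩ := List.eq_nil_or_concat' zs
    · simp at hzn
    rw [regSeq_append] at hys hzs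
    simp only [List.mem_append, List.mem_singleton, or_imp, forall_and, forall_eq] at hym hzm
    obtain ⟨u, hum, hu⟩ := exists_regOn (maximalIdeal R) [K ⊔ ofList ys, K ⊔ ofList zs] (by
      simp only [List.mem_cons, List.not_mem_nil, or_false, forall_eq_or_imp, forall_eq]
      exact ⟨⟨y, hym.2, hys.2.1⟩, ⟨z, hzm.2, hzs.2.1⟩⟩)
    simp only [List.mem_cons, List.not_mem_nil, or_false, forall_eq_or_imp, forall_eq] at hu
    rw [ofList_append, ofList_singleton, ← sup_assoc] at h ⊢
    have h1 := h.exchange hys.2.1 hu.1 hym.2 hum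
    rw [sup_right_comm] at h1
    have h2 := ih (hys.1.rotate hu.1 hym.1 hum).2 (hzs.1.rotate hu.2 hzm.1 hum).2 hym.1 hzm.1
      (by simpa using hyn) (by simpa using hzn) h1
    rw [sup_right_comm] at h2
    exact h2.exchange hu.2 hzs.2.1 hum hzm.2

lemma hasSocle_of_pow_le {q : Ideal R} (hq : q ≠ ⊤) {N : ℕ} (hN : maximalIdeal R ^ N ≤ q) :
    HasSocle q := by
  classical
  have hex : ∃ N, maximalIdeal R ^ N ≤ q := ⟨N, hN⟩
  have hpos : Nat.find hex ≠ 0 := fun h => hq (by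
    have := Nat.find_spec hex
    rw [h, pow_zero, one_eq_top] at this
    exact top_le_iff.1 this)
  obtain ⟨n, hn⟩ := Nat.exists_eq_succ_of_ne_zero hpos
  obtain ⟨w, hw, hwq⟩ := SetLike.not_le_iff_exists.1 (Nat.find_min hex (m := n) (by omega))
  refine ⟨w, hwq, fun a ha => ?_⟩
  have := Nat.find_spec hex
  rw [hn, pow_succ'] at this
  exact this (mul_mem_mul ha hw)

lemma hasSimpleSocle_of_infIrred [IsNoetherianRing R] {q : Ideal R} (hq : InfIrred q)
    (hrad : q.radical = maximalIdeal R) : HasSimpleSocle q := by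
  obtain ⟨N, hN⟩ := q.exists_radical_pow_le_of_fg ((isNoetherianRing_iff_ideal_fg R).1 ‹_› _)
  rw [hrad] at hN
  obtain ⟨w, hw, hmw⟩ := hasSocle_of_pow_le (fun h => hq.1 (by rw [h]; exact isMax_top)) hN
  refine ⟨w, hw, hmw, fun v hv => ?_⟩
  by_cases hvq : v ∈ q
  · exact ⟨0, by simpa⟩
  have hne : ¬ (q ⊔ span {w}) ⊓ (q ⊔ span {v}) ≤ q := fun h => by
    rcases hq.2 (le_antisymm h (le_inf le_sup_left le_sup_left)) with h | h
    · exact hw (h ▸ mem_sup_right (mem_span_singleton_self w))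
    · exact hvq (h ▸ mem_sup_right (mem_span_singleton_self v))
  obtain ⟨x, ⟨h1, h2⟩, hx⟩ := SetLike.not_le_iff_exists.1 hne
  obtain ⟨r, hr⟩ := mem_sup_span_iff.1 h1
  obtain ⟨s, hs⟩ := mem_sup_span_iff.1 h2
  have hsu : IsUnit s := by
    by_contra hsu
    exact hx (by simpa [mul_comm] using q.add_mem hs (hv s hsu))
  obtain ⟨t, ht⟩ := hsu.exists_left_inv
  refine ⟨t * r, ?_⟩
  have := q.mul_mem_left t (q.sub_mem hr hs)
  rwa [show t * (x - w * r - (x - v * s)) = t * s * v - t * r * w by ring, ht, one_mul] at this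

end

section

variable {R : Type*} [CommRing R] [IsLocalRing R]

lemma HasSocle.not_regOn {q : Ideal R} (h : HasSocle q) {a : R} (ha : a ∈ maximalIdeal R) :
    ¬ RegOn q a := by
  obtain ⟨w, hw, hmw⟩ := h
  exact fun h => hw (h w (hmw a ha))

lemma sup_ne_top {K L : Ideal R} (hK : K ≠ ⊤) (hL : L ≤ maximalIdeal R) : K ⊔ L ≠ ⊤ :=
  fun h => (maximalIdeal.isMaximal R).ne_top
    (top_le_iff.1 (h ▸ sup_le (le_maximalIdeal hK) hL))

/-- `R ⧸ K` is Cohen-Macaulay of dimension `n`. -/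
structure CMQuot (K : Ideal R) (n : ℕ) : Prop where
  ne_top : K ≠ ⊤
  dim : ringKrullDim (R ⧸ K) = n
  seq : ∃ l : List R, l.length = n ∧ (∀ a ∈ l, a ∈ maximalIdeal R) ∧ RegSeq K l

lemma CMQuot.exists_regOn {K : Ideal R} {n : ℕ} (h : CMQuot K (n + 1)) :
    ∃ a ∈ maximalIdeal R, RegOn K a := by
  obtain ⟨_ | ⟨a, l⟩, hln, hlm, hl⟩ := h.seq
  · simp at hln
  · exact ⟨a, hlm a (by simp), hl.1⟩

variable [IsNoetherianRing R]

lemma exists_regOn_of_not_hasSocle {K : Ideal R} (h : ¬ HasSocle K) :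
    ∃ a ∈ maximalIdeal R, RegOn K a := by
  by_contra! H
  have hsub : (maximalIdeal R : Set R) ⊆
      ⋃ p ∈ associatedPrimes R (R ⧸ K), ((id p : Ideal R) : Set R) :=
    fun a ha => (biUnion_associatedPrimes K a).2 (H a ha)
  rw [subset_union_prime_finite (f := id) (associatedPrimes.finite R (R ⧸ K)) ⊤ ⊤
    fun p hp _ _ => hp.isPrime] at hsub
  obtain ⟨p, hp, hmp⟩ := hsub
  obtain ⟨hpp, x, hx⟩ := isAssociatedPrime_iff.1 hp
  obtain ⟨w, rfl⟩ := Ideal.Quotient.mk_surjective x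
  have key : ∀ a, a ∈ p ↔ a * w ∈ K := fun a => by
    rw [hx, Submodule.mem_colon_singleton, Submodule.mem_bot, ← Ideal.Quotient.eq_zero_iff_mem]
    rfl
  refine h ⟨w, fun hw => hpp.one_notMem ((key 1).2 (by rwa [one_mul])), fun a ha => ?_⟩
  exact (key a).1 (hmp ha)

/-- Killing a nonzerodivisor lowers the depth by exactly one. -/
lemma RegSeq.exists_of_regOn (n : ℕ) {K : Ideal R} {l : List R} {z : R} (hl : RegSeq K l)
    (hlm : ∀ a ∈ l, a ∈ maximalIdeal R) (hln : l.length = n + 1) (hz : RegOn K z)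
    (hzm : z ∈ maximalIdeal R) :
    ∃ l' : List R, l'.length = n ∧ (∀ a ∈ l', a ∈ maximalIdeal R) ∧
      RegSeq (K ⊔ span {z}) l' := by
  induction n generalizing K l z with
  | zero => exact ⟨[], rfl, by simp, trivial⟩
  | succ n ih =>
    obtain _ | ⟨a, _ | ⟨b, l⟩⟩ := l
    · simp at hln
    · simp at hln
    simp only [List.mem_cons, forall_eq_or_imp] at hlm
    have hsoc : ¬ HasSocle (K ⊔ span {z}) := fun h =>
      (h.exchange hz hl.1 hlm.1).not_regOn hlm.2.1 hl.2.1
    obtain ⟨u, hum, hu⟩ := exists_regOn (maximalIdeal R) [K ⊔ span {z}, K ⊔ span {a}] (by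
      simp only [List.mem_cons, List.not_mem_nil, or_false, forall_eq_or_imp, forall_eq]
      exact ⟨exists_regOn_of_not_hasSocle hsoc, ⟨b, hlm.2.1, hl.2.1⟩⟩)
    simp only [List.mem_cons, List.not_mem_nil, or_false, forall_eq_or_imp, forall_eq] at hu
    obtain ⟨l₁, hl₁n, hl₁m, hl₁⟩ := ih hl.2 (by simpa using hlm.2) (by simpa using hln) hu.2 hum
    have ha := RegSeq.rotate (l := [a]) ⟨hl.1, trivial⟩ (by simpa using hu.2)
      (by simpa using hlm.1) hum
    have hz' := RegSeq.rotate (l := [z]) ⟨hz, trivial⟩ (by simpa using hu.1)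
      (by simpa using hzm) hum
    obtain ⟨l₂, hl₂n, hl₂m, hl₂⟩ := ih (K := K ⊔ span {u}) (l := a :: l₁)
      ⟨ha.2.1, by rwa [sup_right_comm]⟩ (by simpa using ⟨hlm.1, hl₁m⟩) (by simp [hl₁n]) hz'.2.1 hzm
    exact ⟨u :: l₂, by simp [hl₂n], by simpa using ⟨hum, hl₂m⟩, hu.1, by rwa [sup_right_comm]⟩

lemma ringKrullDim_quotient_sup_span {K : Ideal R} {z : R} (hz : RegOn K z)
    (hzm : z ∈ maximalIdeal R) :
    ringKrullDim (R ⧸ (K ⊔ span {z})) + 1 = ringKrullDim (R ⧸ K) := by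
  rw [← Module.supportDim_quotient_eq_ringKrullDim, ← Module.supportDim_quotient_eq_ringKrullDim,
    ← Module.supportDim_eq_of_equiv (quotSMulTopEquiv K z)]
  exact Module.supportDim_quotSMulTop_succ_eq_supportDim (RegOn.isSMulRegular_iff.2 hz) hzm

lemma CMQuot.sup_span {K : Ideal R} {n : ℕ} (h : CMQuot K n) {z : R} (hz : RegOn K z)
    (hzm : z ∈ maximalIdeal R) : ∃ n', n = n' + 1 ∧ CMQuot (K ⊔ span {z}) n' := by
  have hne : K ⊔ span {z} ≠ ⊤ := sup_ne_top h.ne_top ((span_singleton_le_iff_mem _).2 hzm)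
  have := Ideal.Quotient.nontrivial_iff.2 hne
  have hdim := ringKrullDim_quotient_sup_span hz hzm
  have h0 : 0 ≤ ringKrullDim (R ⧸ (K ⊔ span {z})) := ringKrullDim_nonneg_of_nontrivial
  rw [h.dim] at hdim
  obtain ⟨e, he⟩ : ∃ e : ℕ, ringKrullDim (R ⧸ (K ⊔ span {z})) = e := by
    generalize ringKrullDim (R ⧸ (K ⊔ span {z})) = D at *
    induction D with
    | bot => simp at h0
    | coe D =>
      induction D with
      | top => exact absurd (WithBot.coe_inj.1 hdim) (by simp)
      | coe D => exact ⟨D, rfl⟩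
  rw [he] at hdim
  have hn : n = e + 1 := by exact_mod_cast hdim.symm
  obtain ⟨l, hln, hlm, hl⟩ := h.seq
  exact ⟨e, hn, hne, he, hl.exists_of_regOn e hlm (by omega) hz hzm⟩

lemma CMQuot.sup_ofList {K : Ideal R} {n : ℕ} (h : CMQuot K n) {l : List R} (hl : RegSeq K l)
    (hlm : ∀ a ∈ l, a ∈ maximalIdeal R) :
    ∃ n', n = n' + l.length ∧ CMQuot (K ⊔ ofList l) n' := by
  induction l generalizing K n with
  | nil => exact ⟨n, by simp, by simpa⟩
  | cons a l ih =>
    simp only [List.mem_cons, forall_eq_or_imp] at hlm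
    obtain ⟨n', rfl, h'⟩ := h.sup_span hl.1 hlm.1
    obtain ⟨n, rfl, h⟩ := ih h' hl.2 hlm.2
    exact ⟨n, by simp [add_assoc], by rwa [ofList_cons, ← sup_assoc]⟩

lemma CMQuot.pow_le {K : Ideal R} (h : CMQuot K 0) : ∃ N, maximalIdeal R ^ N ≤ K := by
  have := Ideal.Quotient.nontrivial_iff.2 h.ne_top
  have : IsLocalRing (R ⧸ K) := .of_surjective' _ Ideal.Quotient.mk_surjective
  have : Ring.KrullDimLE 0 (R ⧸ K) := Ring.krullDimLE_iff.2 h.dim.le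
  refine exists_pow_le_of_le_radical_of_fg (fun a ha => ?_)
    ((isNoetherianRing_iff_ideal_fg R).1 ‹_› _)
  have ha' : Ideal.Quotient.mk K a ∈ maximalIdeal (R ⧸ K) := fun hu => by
    obtain ⟨b, hb⟩ := hu.exists_right_inv
    obtain ⟨b, rfl⟩ := Ideal.Quotient.mk_surjective b
    rw [← map_mul, ← map_one (Ideal.Quotient.mk K), Ideal.Quotient.eq] at hb
    have := sub_mem ((maximalIdeal R).mul_mem_right b ha) (le_maximalIdeal h.ne_top hb)
    rw [sub_sub_cancel] at this
    exact (maximalIdeal.isMaximal R).ne_top ((eq_top_iff_one _).2 this)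
  obtain ⟨N, hN⟩ := Ring.KrullDimLE.isNilpotent_iff_mem_maximalIdeal.2 ha'
  rw [← map_pow, Ideal.Quotient.eq_zero_iff_mem] at hN
  exact ⟨N, hN⟩

/-- Two Cohen-Macaulay quotients have a common maximal regular sequence. -/
lemma CMQuot.exists_common {c K : Ideal R} {n k : ℕ} (hc : CMQuot c (n + k)) (hK : CMQuot K n) :
    ∃ l : List R, l.length = n ∧ (∀ a ∈ l, a ∈ maximalIdeal R) ∧ RegSeq c l ∧ RegSeq K l := by
  induction n generalizing c K with
  | zero => exact ⟨[], rfl, by simp, trivial, trivial⟩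
  | succ n ih =>
    rw [add_right_comm] at hc
    obtain ⟨u, hum, hu⟩ := Linkage.exists_regOn (maximalIdeal R) [c, K] (by
      simp only [List.mem_cons, List.not_mem_nil, or_false, forall_eq_or_imp, forall_eq]
      exact ⟨hc.exists_regOn, hK.exists_regOn⟩)
    simp only [List.mem_cons, List.not_mem_nil, or_false, forall_eq_or_imp, forall_eq] at hu
    obtain ⟨_, h1, hc'⟩ := hc.sup_span hu.1 hum
    obtain ⟨_, h2, hK'⟩ := hK.sup_span hu.2 hum
    cases h1
    cases h2
    obtain ⟨l, hln, hlm, h⟩ := ih hc' hK'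
    exact ⟨u :: l, by simp [hln], by simpa using ⟨hum, hlm⟩, ⟨hu.1, h.1⟩, ⟨hu.2, h.2⟩⟩

end

section

lemma regSeq_map_mk {R : Type*} [CommRing R] (K : Ideal R) (l : List R) :
    RegSeq ⊥ (l.map (Ideal.Quotient.mk K)) ↔ RegSeq K l := by
  rw [← regSeq_comap_iff Ideal.Quotient.mk_surjective, ← RingHom.ker_eq_comap_bot, mk_ker]

lemma exists_of_isCMLocalRing {A : Type} [CommRing A] [IsLocalRing A] [IsNoetherianRing A]
    (h : IsCMLocalRing A) : ∃ n : ℕ, ringKrullDim A = n ∧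
      ∃ l : List A, l.length = n ∧ (∀ a ∈ l, a ∈ maximalIdeal A) ∧ RegSeq ⊥ l := by
  let s : Set ℕ := {n : ℕ | ∃ rs : List A, rs.length = n ∧ (∀ r ∈ rs, r ∈ maximalIdeal A) ∧
    IsRegular A rs}
  have h : ringKrullDim A = ((sSup s : ℕ) : WithBot ℕ∞) := h
  have hmem : sSup s ∈ s := by
    refine Nat.sSup_mem ⟨0, [], rfl, by simp, ?_⟩ ⟨sSup s, ?_⟩
    · rw [isRegular_iff_regSeq]
      exact ⟨trivial, by simp⟩
    · rintro _ ⟨rs, rfl, -, hrs⟩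
      have hd := ringKrullDim_add_length_eq_ringKrullDim_of_isRegular rs hrs
      have := Ideal.Quotient.nontrivial_iff.2 ((isRegular_iff_regSeq rs).1 hrs).2
      have h0 : 0 ≤ ringKrullDim (A ⧸ ofList rs) := ringKrullDim_nonneg_of_nontrivial
      have h1 : (rs.length : WithBot ℕ∞) ≤ ringKrullDim A := by
        rw [← hd]
        exact le_add_of_nonneg_left h0
      rw [h] at h1
      exact_mod_cast h1
  obtain ⟨l, hl, hlm, hreg⟩ := hmem
  exact ⟨_, h, l, hl, hlm, ((isRegular_iff_regSeq l).1 hreg).1⟩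

lemma exists_cmQuot_of_isCMIdeal {R : Type} [CommRing R] [IsLocalRing R] [IsNoetherianRing R]
    {I : Ideal R} (h : IsCMIdeal R I) : ∃ n, CMQuot I n := by
  obtain ⟨hloc, hCM⟩ := h
  obtain ⟨n, hn, l, hln, hlm, hl⟩ := exists_of_isCMLocalRing hCM
  obtain ⟨l, rfl⟩ := (List.map_surjective_iff.2 Ideal.Quotient.mk_surjective) l
  refine ⟨n, Ideal.Quotient.nontrivial_iff.1 inferInstance, hn, l, by simpa using hln,
    fun a ha hu => ?_, (regSeq_map_mk I l).1 hl⟩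
  exact hlm _ (List.mem_map_of_mem ha) (hu.map _)

/-- The properties of Gorenstein local rings of dimension `d` used below. -/
structure GorLocal (R : Type*) [CommRing R] [IsLocalRing R] (d : ℕ) : Prop where
  cm : CMQuot (⊥ : Ideal R) d
  socle : ∀ l : List R, l.length = d → (∀ a ∈ l, a ∈ maximalIdeal R) → RegSeq ⊥ l →
    HasSimpleSocle (ofList l)

lemma exists_gorLocal {R : Type} [CommRing R] [IsLocalRing R] [IsNoetherianRing R]
    (h : IsGorensteinLocalRing R) : ∃ d, GorLocal R d := by
  obtain ⟨hCM, rs, hrs, hrad, hirr⟩ := h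
  obtain ⟨d, hd, l, hl⟩ := exists_of_isCMLocalRing hCM
  have hcm : CMQuot (⊥ : Ideal R) d :=
    ⟨bot_ne_top, by rw [ringKrullDim_eq_of_ringEquiv (RingEquiv.quotientBot R), hd], l, hl⟩
  rw [isRegular_iff_regSeq] at hrs
  have hrsm : ∀ a ∈ rs, a ∈ maximalIdeal R := fun a ha => le_maximalIdeal hrs.2 (mem_ofList ha)
  obtain ⟨n, hn, h'⟩ := hcm.sup_ofList hrs.1 hrsm
  rw [bot_sup_eq] at h'
  have hlen : rs.length = d := by
    rcases n with _ | n
    · omega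
    · obtain ⟨y, hym, hy⟩ := h'.exists_regOn
      rw [← hrad] at hym
      obtain ⟨N, hN⟩ := hym
      exact absurd ((eq_top_iff_one _).2 (hy.pow N 1 (by rwa [mul_one]))) hrs.2
  refine ⟨d, hcm, fun l hln hlm hl => ?_⟩
  have := HasSimpleSocle.of_regSeq d hrs.1 hl hrsm hlm hlen hln (by
    rw [bot_sup_eq]
    exact hasSimpleSocle_of_infIrred hirr hrad)
  rwa [bot_sup_eq] at this

end

section

variable {R : Type*} [CommRing R]

/-- `g` represents an `R`-linear map `K ⧸ c → R ⧸ c`. -/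
structure IsHomMod (c K : Ideal R) (g : R → R) : Prop where
  add : ∀ x ∈ K, ∀ y ∈ K, g (x + y) - (g x + g y) ∈ c
  mul : ∀ r, ∀ x ∈ K, g (r * x) - r * g x ∈ c
  zero : ∀ x ∈ c, g x ∈ c

/-- Every linear map `K ⧸ c → R ⧸ c` is multiplication by an element of `R`. -/
def HomsPrincipal (c K : Ideal R) : Prop :=
  ∀ g, IsHomMod c K g → ∃ b, ∀ x ∈ K, g x - b * x ∈ c

lemma IsHomMod.sub_mul {c K : Ideal R} {g : R → R} (h : IsHomMod c K g) (b : R) :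
    IsHomMod c K fun x => g x - b * x where
  add x hx y hy := by
    have := h.add x hx y hy
    ring_nf at this ⊢
    exact this
  mul r x hx := by
    have := h.mul r x hx
    ring_nf at this ⊢
    exact this
  zero x hx := c.sub_mem (h.zero x hx) (c.mul_mem_left b hx)

/-- Two representatives with the same class have the same image. -/
lemma IsHomMod.sub_mem {c K : Ideal R} {g : R → R} (h : IsHomMod c K g) {x y : R} (hx : x ∈ K)
    (hcK : c ≤ K) (hxy : x - y ∈ c) : g x - g y ∈ c := by
  have hy : y ∈ K := by simpa using K.sub_mem hx (hcK hxy)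
  have h1 := h.add (x - y) (hcK hxy) y hy
  rw [sub_add_cancel] at h1
  convert c.add_mem h1 (h.zero _ hxy) using 1
  ring

/-- The colength of an ideal. -/
noncomputable def colength (K : Ideal R) : ℕ := (Module.length R (R ⧸ K)).toNat

variable [IsLocalRing R]

lemma length_eq_succ {K : Ideal R} {w : R} (hw : w ∉ K)
    (hmw : ∀ a ∈ maximalIdeal R, a * w ∈ K) :
    Module.length R (R ⧸ K) = 1 + Module.length R (R ⧸ (K ⊔ span {w})) := by
  let f : (R ⧸ maximalIdeal R) →ₗ[R] R ⧸ K :=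
    (maximalIdeal R).liftQ (LinearMap.toSpanSingleton R (R ⧸ K) (Ideal.Quotient.mk K w))
      fun a ha => by
        rw [LinearMap.mem_ker, LinearMap.toSpanSingleton_apply]
        exact Ideal.Quotient.eq_zero_iff_mem.2 (hmw a ha)
  let g : (R ⧸ K) →ₗ[R] R ⧸ (K ⊔ span {w}) := Submodule.factor le_sup_left
  have hf : Function.Injective f := by
    rw [← LinearMap.ker_eq_bot, Submodule.ker_liftQ_eq_bot]
    intro a ha hu
    rw [LinearMap.mem_ker, LinearMap.toSpanSingleton_apply] at ha
    have ha : a * w ∈ K := Ideal.Quotient.eq_zero_iff_mem.1 ha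
    exact hw ((K.unit_mul_mem_iff_mem hu).1 ha)
  have hg : Function.Surjective g := Submodule.factor_surjective _
  have hfg : Function.Exact f g := by
    intro x
    obtain ⟨x, rfl⟩ := Ideal.Quotient.mk_surjective x
    have : g (Ideal.Quotient.mk K x) = Ideal.Quotient.mk _ x := rfl
    rw [this, Ideal.Quotient.eq_zero_iff_mem, mem_sup_span_iff]
    constructor
    · rintro ⟨t, ht⟩
      refine ⟨Ideal.Quotient.mk _ t, ?_⟩
      have : f (Ideal.Quotient.mk _ t) = Ideal.Quotient.mk K (t * w) := rfl
      rw [this, eq_comm, Ideal.Quotient.eq, mul_comm]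
      exact ht
    · rintro ⟨t, ht⟩
      obtain ⟨t, rfl⟩ := Ideal.Quotient.mk_surjective t
      have : f (Ideal.Quotient.mk _ t) = Ideal.Quotient.mk K (t * w) := rfl
      rw [this, eq_comm, Ideal.Quotient.eq, mul_comm] at ht
      exact ⟨t, ht⟩
  rw [Module.length_eq_add_of_exact f g hf hg hfg]
  have : IsSimpleModule R (R ⧸ maximalIdeal R) :=
    isSimpleModule_iff_isCoatom.2 (maximalIdeal.isMaximal R).out
  rw [Module.length_eq_one]

lemma exists_socle_mem {K L : Ideal R} {N : ℕ} (hN : maximalIdeal R ^ N ≤ K) (h : ¬ L ≤ K) :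
    ∃ x ∈ L, x ∉ K ∧ ∀ a ∈ maximalIdeal R, a * x ∈ K := by
  classical
  have hex : ∃ N, maximalIdeal R ^ N * L ≤ K := ⟨N, Ideal.mul_le_left.trans hN⟩
  have hpos : Nat.find hex ≠ 0 := fun h0 => h (by
    have := Nat.find_spec hex
    rwa [h0, pow_zero, one_mul] at this)
  obtain ⟨n, hn⟩ := Nat.exists_eq_succ_of_ne_zero hpos
  obtain ⟨x, hx, hxK⟩ := SetLike.not_le_iff_exists.1 (Nat.find_min hex (m := n) (by omega))
  refine ⟨x, Ideal.mul_le_right hx, hxK, fun a ha => ?_⟩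
  have := Nat.find_spec hex
  rw [hn, pow_succ', mul_assoc] at this
  exact this (mul_mem_mul ha hx)

lemma HasSimpleSocle.exists_unit {q : Ideal R} (h : HasSimpleSocle q) {v : R} (hv : v ∉ q)
    (hmv : ∀ a ∈ maximalIdeal R, a * v ∈ q) (v' : R) (hv' : ∀ a ∈ maximalIdeal R, a * v' ∈ q) :
    ∃ r, v' - r * v ∈ q := by
  obtain ⟨w, hw, hmw, hsoc⟩ := h
  obtain ⟨r, hr⟩ := hsoc v hmv
  obtain ⟨r', hr'⟩ := hsoc v' hv'
  have hu : IsUnit r := by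
    by_contra hu
    exact hv (by simpa using q.add_mem hr (hmw r hu))
  obtain ⟨s, hs⟩ := hu.exists_left_inv
  refine ⟨r' * s, ?_⟩
  have := q.sub_mem hr' (q.mul_mem_left (r' * s) hr)
  rwa [show v' - r' * w - r' * s * (v - r * w) = v' - r' * s * v - r' * (1 - s * r) * w by ring,
    hs, sub_self, mul_zero, zero_mul, sub_zero] at this

variable [IsNoetherianRing R]

lemma length_ne_top {K : Ideal R} {N : ℕ} (hN : maximalIdeal R ^ N ≤ K) :
    Module.length R (R ⧸ K) ≠ ⊤ := by
  induction K using WellFoundedGT.induction with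
  | ind K ih =>
    by_cases hK : K = ⊤
    · subst hK
      have : Subsingleton (R ⧸ (⊤ : Ideal R)) := Ideal.Quotient.subsingleton_iff.2 rfl
      rw [Module.length_eq_zero]
      simp
    · obtain ⟨x, -, hx, hmx⟩ := exists_socle_mem hN (fun h => hK (top_le_iff.1 h))
      rw [length_eq_succ hx hmx]
      have := ih (K ⊔ span {x}) (by
        simpa [left_lt_sup, span_singleton_le_iff_mem] using hx) (hN.trans le_sup_left)
      simpa using this

lemma colength_eq_succ {K : Ideal R} {N : ℕ} (hN : maximalIdeal R ^ N ≤ K) {w : R} (hw : w ∉ K)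
    (hmw : ∀ a ∈ maximalIdeal R, a * w ∈ K) : colength K = colength (K ⊔ span {w}) + 1 := by
  have h := length_ne_top (hN.trans (le_sup_left (b := span {w})))
  rw [colength, length_eq_succ hw hmw, ENat.toNat_add (by simp) h, add_comm]
  rfl

lemma colength_colon_le {q K : Ideal R} (hq : HasSimpleSocle q) {N : ℕ}
    (hN : maximalIdeal R ^ N ≤ q) {x : R} (hmx : ∀ a ∈ maximalIdeal R, a * x ∈ K) :
    colength (Submodule.colon q ((K ⊔ span {x} : Ideal R) : Set R)) ≤
      colength (Submodule.colon q (K : Set R)) + 1 := by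
  by_cases h : ∀ e ∈ Submodule.colon q (K : Set R), e * x ∈ q
  · have : Submodule.colon q ((K ⊔ span {x} : Ideal R) : Set R) =
        Submodule.colon q (K : Set R) :=
      le_antisymm (colon_anti le_sup_left) fun e he => mem_colon_sup_span.2 ⟨he, h e he⟩
    rw [this]
    exact Nat.le_succ _
  push Not at h
  obtain ⟨e, he, hex⟩ := h
  have key : ∀ b ∈ Submodule.colon q (K : Set R), ∀ a ∈ maximalIdeal R, a * (b * x) ∈ q := by
    intro b hb a ha
    rw [mul_left_comm]
    exact mem_colon_ideal.1 hb _ (hmx a ha)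
  have hsup : Submodule.colon q ((K ⊔ span {x} : Ideal R) : Set R) ⊔ span {e} =
      Submodule.colon q (K : Set R) := by
    refine le_antisymm (sup_le (colon_anti le_sup_left) ((span_singleton_le_iff_mem _).2 he))
      fun b hb => mem_sup_span_iff.2 ?_
    obtain ⟨r, hr⟩ := hq.exists_unit hex (key e he) (b * x) (key b hb)
    refine ⟨r, mem_colon_sup_span.2 ⟨sub_mem hb (Ideal.mul_mem_right r _ he), ?_⟩⟩
    ring_nf at hr ⊢
    exact hr
  rw [← hsup, colength_eq_succ (hN.trans le_colon) (fun h => hex (mem_colon_sup_span.1 h).2)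
    fun a ha => mem_colon_sup_span.2 ⟨Ideal.mul_mem_left _ a he, ?_⟩]
  rw [mul_assoc]
  exact key e he a ha

lemma colength_add_colength_colon_anti {q K L : Ideal R} (hq : HasSimpleSocle q) {N : ℕ}
    (hN : maximalIdeal R ^ N ≤ q) (hqK : q ≤ K) (hKL : K ≤ L) :
    colength (Submodule.colon q (L : Set R)) + colength L ≤
      colength (Submodule.colon q (K : Set R)) + colength K := by
  induction K using WellFoundedGT.induction with
  | ind K ih =>
    by_cases hLK : L ≤ K
    · rw [le_antisymm hLK hKL]
    · obtain ⟨x, hxL, hx, hmx⟩ := exists_socle_mem (hN.trans hqK) hLK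
      have h1 := ih (K ⊔ span {x}) (by
        simpa [left_lt_sup, span_singleton_le_iff_mem] using hx) (hqK.trans le_sup_left)
        (sup_le hKL ((span_singleton_le_iff_mem _).2 hxL))
      have h2 := colength_colon_le hq hN hmx
      have h3 := colength_eq_succ (hN.trans hqK) hx hmx
      omega

lemma colength_colon_add {q K : Ideal R} (hq : HasSimpleSocle q) {N : ℕ}
    (hN : maximalIdeal R ^ N ≤ q) (hqK : q ≤ K) :
    colength (Submodule.colon q (K : Set R)) + colength K = colength q := by
  have h1 := colength_add_colength_colon_anti hq hN le_rfl hqK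
  have h2 := colength_add_colength_colon_anti hq hN hqK le_top
  have h0 : colength (⊤ : Ideal R) = 0 := by
    have : Subsingleton (R ⧸ (⊤ : Ideal R)) := Ideal.Quotient.subsingleton_iff.2 rfl
    rw [colength, Module.length_eq_zero, ENat.toNat_zero]
  rw [colon_self] at h1
  rw [colon_top] at h2
  omega

/-- Self-injectivity of Artinian local rings with simple socle. -/
lemma HasSimpleSocle.homsPrincipal {q L : Ideal R} (hq : HasSimpleSocle q) {N : ℕ}
    (hN : maximalIdeal R ^ N ≤ q) (hqL : q ≤ L) : HomsPrincipal q L := by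
  suffices H : ∀ K, q ≤ K → K ≤ L → ∀ g, IsHomMod q L g → (∀ x ∈ K, g x ∈ q) →
      ∃ b, ∀ x ∈ L, g x - b * x ∈ q from fun g hg => H q le_rfl hqL g hg hg.zero
  intro K hqK hKL
  induction K using WellFoundedGT.induction with
  | ind K ih =>
    intro g hg hgK
    by_cases hLK : L ≤ K
    · exact ⟨0, fun x hx => by simpa using hgK x (hLK hx)⟩
    obtain ⟨x, hxL, hx, hmx⟩ := exists_socle_mem (hN.trans hqK) hLK
    obtain ⟨e, he, hex⟩ : ∃ e ∈ Submodule.colon q (K : Set R), e * x ∉ q := by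
      by_contra! h
      have : Submodule.colon q ((K ⊔ span {x} : Ideal R) : Set R) =
          Submodule.colon q (K : Set R) :=
        le_antisymm (colon_anti le_sup_left) fun e he => mem_colon_sup_span.2 ⟨he, h e he⟩
      have h1 := colength_colon_add hq hN hqK
      have h2 := colength_colon_add hq hN (hqK.trans (le_sup_left (b := span {x})))
      have h3 := colength_eq_succ (hN.trans hqK) hx hmx
      rw [this] at h2
      omega
    obtain ⟨r, hr⟩ := hq.exists_unit hex (fun a ha => by
      rw [mul_left_comm]
      exact mem_colon_ideal.1 he _ (hmx a ha)) (g x) fun a ha => by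
        have := q.sub_mem (hgK _ (hmx a ha)) (hg.mul a x hxL)
        rwa [sub_sub_cancel] at this
    obtain ⟨b, hb⟩ := ih (K ⊔ span {x}) (by
        simpa [left_lt_sup, span_singleton_le_iff_mem] using hx) (hqK.trans le_sup_left)
        (sup_le hKL ((span_singleton_le_iff_mem _).2 hxL)) _ (hg.sub_mul (r * e)) (by
      intro y hy
      obtain ⟨t, ht⟩ := mem_sup_span_iff.1 hy
      have h1 := hg.add (y - x * t) (hKL ht) (x * t) (L.mul_mem_right t hxL)
      rw [sub_add_cancel] at h1
      have h2 := hg.mul t x hxL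
      rw [mul_comm t x] at h2
      have h3 := q.mul_mem_left r (mem_colon_ideal.1 he _ ht)
      have := q.sub_mem (q.add_mem (q.add_mem (q.add_mem h1 h2) (hgK _ ht)) (q.mul_mem_left t hr)) h3
      ring_nf at this ⊢
      exact this)
    refine ⟨b + r * e, fun y hy => ?_⟩
    have := hb y hy
    ring_nf at this ⊢
    exact this

end

section

variable {R : Type*} [CommRing R]

lemma colon_sup_span_le {c K : Ideal R} {y : R} :
    Submodule.colon c (K : Set R) ⊔ span {y} ≤
      Submodule.colon (c ⊔ span {y}) ((K ⊔ span {y} : Ideal R) : Set R) := by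
  refine sup_le (fun a ha => mem_colon_sup_span.2 ⟨mem_colon_ideal.2 fun s hs =>
    mem_sup_left (mem_colon_ideal.1 ha s hs), Ideal.mul_mem_left _ a
      (mem_sup_right (mem_span_singleton_self y))⟩) (le_sup_right.trans le_colon)

lemma IsHomMod.forall_mem {c : Ideal R} {g : R → R} {s : Set R} (h : IsHomMod c (span s) g)
    (hs : ∀ x ∈ s, g x ∈ c) : ∀ x ∈ span s, g x ∈ c := by
  intro x hx
  induction hx using Submodule.span_induction with
  | mem x hx => exact hs x hx
  | zero => exact h.zero 0 c.zero_mem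
  | add x y hx hy hgx hgy => simpa using c.add_mem (h.add x hx y hy) (c.add_mem hgx hgy)
  | smul r x hx hgx => simpa using c.add_mem (h.mul r x hx) (c.mul_mem_left r hgx)

/-- Division of a homomorphism by a nonzerodivisor. -/
lemma IsHomMod.exists_div {c K : Ideal R} {g : R → R} {y : R} (h : IsHomMod c K g)
    (hcK : c ≤ K) (hy : RegOn c y) (hg : ∀ x ∈ K, g x ∈ c ⊔ span {y}) :
    ∃ g', IsHomMod c K g' ∧ ∀ x ∈ K, g x - y * g' x ∈ c := by
  classical
  choose! g' hg' using fun x hx => mem_sup_span_iff.1 (hg x hx)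
  refine ⟨g', ⟨fun x hx z hz => hy _ ?_, fun r x hx => hy _ ?_, fun x hx => hy _ ?_⟩, hg'⟩
  · convert c.sub_mem (c.add_mem (h.add x hx z hz) (c.add_mem (hg' x hx) (hg' z hz)))
      (hg' _ (K.add_mem hx hz)) using 1
    ring
  · convert c.sub_mem (c.add_mem (h.mul r x hx) (c.mul_mem_left r (hg' x hx)))
      (hg' _ (K.mul_mem_left r hx)) using 1
    ring
  · simpa using c.sub_mem (h.zero x hx) (hg' x (hcK hx))

/-- A homomorphism reduces modulo a nonzerodivisor. -/
lemma IsHomMod.exists_reduction {c K : Ideal R} {g : R → R} {y : R} (h : IsHomMod c K g)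
    (hcK : c ≤ K) (hy : RegOn K y) :
    ∃ g', IsHomMod (c ⊔ span {y}) (K ⊔ span {y}) g' ∧ ∀ x ∈ K, g' x - g x ∈ c ⊔ span {y} := by
  classical
  choose! t ht using fun x (hx : x ∈ K ⊔ span {y}) => mem_sup_span_iff.1 hx
  have key : ∀ x z, x ∈ K → z ∈ K → (∃ s, x - z = y * s) → g x - g z ∈ c ⊔ span {y} := by
    rintro x z hx hz ⟨s, hs⟩
    have hsK : s ∈ K := hy s (hs ▸ K.sub_mem hx hz)
    refine mem_sup_span_iff.2 ⟨g s, ?_⟩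
    have h1 := h.add z hz (y * s) (K.mul_mem_left y hsK)
    rw [← hs, add_sub_cancel, hs] at h1
    convert c.add_mem h1 (h.mul y s hsK) using 1
    ring
  have hmem : ∀ x ∈ K, x ∈ K ⊔ span {y} := fun x hx => mem_sup_left hx
  refine ⟨fun x => g (x - y * t x), ⟨fun x hx z hz => ?_, fun r x hx => ?_, fun x hx => ?_⟩,
    fun x hx => key _ _ (ht x (hmem x hx)) hx ⟨-t x, by ring⟩⟩
  · have h1 := mem_sup_left (T := span {y}) (h.add _ (ht x hx) _ (ht z hz))
    have h2 := key _ _ (ht _ (add_mem hx hz)) (K.add_mem (ht x hx) (ht z hz))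
      ⟨t x + t z - t (x + z), by ring⟩
    convert add_mem h1 h2 using 1
    ring
  · have h1 := mem_sup_left (T := span {y}) (h.mul r _ (ht x hx))
    have h2 := key _ _ (ht _ (Ideal.mul_mem_left _ r hx)) (K.mul_mem_left r (ht x hx))
      ⟨r * t x - t (r * x), by ring⟩
    convert add_mem h1 h2 using 1
    ring
  · obtain ⟨s, hs⟩ := mem_sup_span_iff.1 hx
    have hx' : x ∈ K ⊔ span {y} := sup_le_sup_right hcK _ hx
    have h1 := key _ _ (ht x hx') (hcK hs) ⟨s - t x, by ring⟩
    have := add_mem h1 (mem_sup_left (T := span {y}) (h.zero _ hs))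
    simpa using this

lemma HomsPrincipal.colon_sup_span {c K : Ideal R} {y : R} (h : HomsPrincipal c K) (hcK : c ≤ K)
    (hy : RegOn c y) :
    Submodule.colon (c ⊔ span {y}) ((K ⊔ span {y} : Ideal R) : Set R) =
      Submodule.colon c (K : Set R) ⊔ span {y} := by
  refine le_antisymm (fun a ha => ?_) colon_sup_span_le
  have hmul : IsHomMod c K fun x => a * x :=
    ⟨fun x _ z _ => by simp [mul_add], fun r x _ => by simp [mul_left_comm],
      fun x hx => c.mul_mem_left a hx⟩
  obtain ⟨g, hg, hga⟩ := hmul.exists_div hcK hy fun x hx =>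
    mem_colon_ideal.1 ha x (mem_sup_left hx)
  obtain ⟨b, hb⟩ := h g hg
  refine mem_sup_span_iff.2 ⟨b, mem_colon_ideal.2 fun x hx => ?_⟩
  convert c.add_mem (hga x hx) (c.mul_mem_left y (hb x hx)) using 1
  ring

/-- `ψ` surjective: homomorphisms over the source are homomorphisms over the target. -/
lemma HomsPrincipal.comap {A : Type*} [CommRing A] {ψ : A →+* R} (hψ : Function.Surjective ψ)
    {c K : Ideal R} (hcK : c ≤ K) (h : HomsPrincipal c K) :
    HomsPrincipal (c.comap ψ) (K.comap ψ) := by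
  intro g hg
  have hle : c.comap ψ ≤ K.comap ψ := comap_mono hcK
  let σ := Function.surjInv hψ
  have hσ : ∀ r, ψ (σ r) = r := Function.surjInv_eq hψ
  have key : ∀ x z, ψ x ∈ K → ψ x - ψ z ∈ c → ψ (g x) - ψ (g z) ∈ c := fun x z hx hxz => by
    rw [← map_sub] at hxz ⊢
    exact hg.sub_mem hx hle hxz
  have hg' : IsHomMod c K fun r => ψ (g (σ r)) := by
    refine ⟨fun x hx z hz => ?_, fun r x hx => ?_, fun x hx => ?_⟩
    · have h1 : ψ _ ∈ c := hg.add (σ x) (by simpa [hσ] using hx) (σ z) (by simpa [hσ] using hz)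
      have h2 := key (σ (x + z)) (σ x + σ z) (by rw [hσ]; exact K.add_mem hx hz) (by simp [hσ])
      rw [map_sub, map_add] at h1
      simpa using c.add_mem h1 h2
    · have h1 : ψ _ ∈ c := hg.mul (σ r) (σ x) (by simpa [hσ] using hx)
      have h2 := key (σ (r * x)) (σ r * σ x) (by rw [hσ]; exact K.mul_mem_left r hx) (by simp [hσ])
      rw [map_sub, map_mul, hσ] at h1
      simpa using c.add_mem h1 h2
    · exact hg.zero (σ x) (by simpa [hσ] using hx)
  obtain ⟨b, hb⟩ := h _ hg'
  refine ⟨σ b, fun x hx => ?_⟩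
  have h1 := hb (ψ x) hx
  have h2 := key x (σ (ψ x)) hx (by simp [hσ])
  rw [mem_comap, map_sub, map_mul, hσ]
  simpa using c.add_mem h2 h1

variable [IsLocalRing R]

lemma le_of_le_sup_span_mul {M : Type*} [AddCommGroup M] [Module R M] [IsNoetherian R M]
    {y : R} (hy : y ∈ maximalIdeal R) {H N : Submodule R M}
    (h : ∀ v ∈ H, ∃ u ∈ H, v - y • u ∈ N) : H ≤ N := by
  refine Submodule.le_of_le_smul_of_le_jacobson_bot (I := span {y}) (IsNoetherian.noetherian H)
    ?_ fun v hv => ?_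
  · rw [IsLocalRing.jacobson_eq_maximalIdeal _ bot_ne_top]
    exact (span_singleton_le_iff_mem _).2 hy
  · obtain ⟨u, hu, huv⟩ := h v hv
    exact Submodule.mem_sup.2 ⟨_, huv, _,
      Submodule.smul_mem_smul (mem_span_singleton_self y) hu, sub_add_cancel _ _⟩

lemma colon_colon_le_of_homsPrincipal {q K : Ideal R} (hqK : q ≤ K) (hq : HasSocle q)
    (h : ∀ L, q ≤ L → HomsPrincipal q L) :
    Submodule.colon q (Submodule.colon q (K : Set R) : Set R) ≤ K := by
  classical
  intro z hz
  by_contra hzK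
  obtain ⟨w, hw, hmw⟩ := hq
  choose! t ht using fun x (hx : x ∈ K ⊔ span {z}) => mem_sup_span_iff.1 hx
  have key : ∀ r, z * r ∈ K → r * w ∈ q := fun r hr =>
    hmw r fun hu => hzK ((K.mul_unit_mem_iff_mem hu).1 hr)
  have hg : IsHomMod q (K ⊔ span {z}) fun x => t x * w := by
    refine ⟨fun x hx y hy => ?_, fun r x hx => ?_, fun x hx => key _ ?_⟩
    · convert key (t (x + y) - (t x + t y)) ?_ using 1
      · ring
      · convert K.sub_mem (K.add_mem (ht x hx) (ht y hy)) (ht _ (add_mem hx hy)) using 1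
        ring
    · convert key (t (r * x) - r * t x) ?_ using 1
      · ring
      · convert K.sub_mem (K.mul_mem_left r (ht x hx)) (ht _ (Ideal.mul_mem_left _ r hx)) using 1
        ring
    · simpa using K.sub_mem (hqK hx) (ht x (mem_sup_left (hqK hx)))
  obtain ⟨b, hb⟩ := h _ (hqK.trans le_sup_left) _ hg
  have hbK : b ∈ Submodule.colon q (K : Set R) := mem_colon_ideal.2 fun x hx => by
    have h1 := key (t x) (by simpa using K.sub_mem hx (ht x (mem_sup_left hx)))
    simpa using q.sub_mem h1 (hb x (mem_sup_left hx))
  have hz' : z ∈ K ⊔ span {z} := mem_sup_right (mem_span_singleton_self z)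
  have h1 := key (1 - t z) (by simpa [mul_sub] using ht z hz')
  have h2 := mem_colon_ideal.1 hz b hbK
  apply hw
  convert q.add_mem (q.add_mem h1 (hb z hz')) h2 using 1
  ring

variable [IsNoetherianRing R]

lemma HomsPrincipal.of_sup_span {c K : Ideal R} {y : R} (hym : y ∈ maximalIdeal R)
    (hcK : c ≤ K) (hyc : RegOn c y) (hyK : RegOn K y)
    (h : HomsPrincipal (c ⊔ span {y}) (K ⊔ span {y})) : HomsPrincipal c K := by
  obtain ⟨n, k, hk⟩ := Submodule.fg_iff_exists_fin_generating_family.1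
    ((isNoetherianRing_iff_ideal_fg R).1 ‹_› K)
  have hkK : ∀ i, k i ∈ K := fun i => hk ▸ Submodule.subset_span (Set.mem_range_self i)
  let H : Submodule R (Fin n → R) :=
    { carrier := {v | ∃ g, IsHomMod c K g ∧ ∀ i, v i - g (k i) ∈ c}
      add_mem' := by
        rintro v w ⟨g, hg, hgv⟩ ⟨g', hg', hgw⟩
        refine ⟨fun x => g x + g' x, ⟨fun x hx z hz => ?_, fun r x hx => ?_, fun x hx =>
          c.add_mem (hg.zero x hx) (hg'.zero x hx)⟩, fun i => ?_⟩
        · convert c.add_mem (hg.add x hx z hz) (hg'.add x hx z hz) using 1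
          ring
        · convert c.add_mem (hg.mul r x hx) (hg'.mul r x hx) using 1
          ring
        · convert c.add_mem (hgv i) (hgw i) using 1
          simp only [Pi.add_apply]
          ring
      zero_mem' := ⟨fun _ => 0, ⟨by simp, by simp, by simp⟩, by simp⟩
      smul_mem' := by
        rintro a v ⟨g, hg, hgv⟩
        refine ⟨fun x => a * g x, ⟨fun x hx z hz => ?_, fun r x hx => ?_, fun x hx =>
          c.mul_mem_left a (hg.zero x hx)⟩, fun i => ?_⟩
        · convert c.mul_mem_left a (hg.add x hx z hz) using 1
          ring
        · convert c.mul_mem_left a (hg.mul r x hx) using 1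
          ring
        · convert c.mul_mem_left a (hgv i) using 1
          simp only [Pi.smul_apply, smul_eq_mul]
          ring }
  let N : Submodule R (Fin n → R) :=
    { carrier := {v | ∃ b, ∀ i, v i - b * k i ∈ c}
      add_mem' := by
        rintro v w ⟨b, hb⟩ ⟨b', hb'⟩
        refine ⟨b + b', fun i => ?_⟩
        convert c.add_mem (hb i) (hb' i) using 1
        simp only [Pi.add_apply]
        ring
      zero_mem' := ⟨0, by simp⟩
      smul_mem' := by
        rintro a v ⟨b, hb⟩
        refine ⟨a * b, fun i => ?_⟩
        convert c.mul_mem_left a (hb i) using 1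
        simp only [Pi.smul_apply, smul_eq_mul]
        ring }
  have hHN : H ≤ N := by
    refine le_of_le_sup_span_mul hym ?_
    rintro v ⟨g, hg, hgv⟩
    obtain ⟨g₁, hg₁, hg₁g⟩ := hg.exists_reduction hcK hyK
    obtain ⟨b, hb⟩ := h g₁ hg₁
    obtain ⟨g₂, hg₂, hg₂g⟩ := (hg.sub_mul b).exists_div hcK hyc fun x hx => by
      convert sub_mem (hb x (mem_sup_left hx)) (hg₁g x hx) using 1
      ring
    refine ⟨fun i => g₂ (k i), ⟨g₂, hg₂, by simp⟩, b, fun i => ?_⟩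
    convert c.add_mem (hgv i) (hg₂g (k i) (hkK i)) using 1
    simp only [Pi.sub_apply, Pi.smul_apply, smul_eq_mul]
    ring
  intro g hg
  obtain ⟨b, hb⟩ := hHN (show (fun i => g (k i)) ∈ H from ⟨g, hg, by simp⟩)
  refine ⟨b, ?_⟩
  have hK : span (Set.range k) = K := hk
  have := hg.sub_mul b
  rw [← hK] at this ⊢
  exact this.forall_mem (by rintro _ ⟨i, rfl⟩; exact hb i)

lemma colon_colon_le_of_sup_span {c K : Ideal R} {y : R} (hym : y ∈ maximalIdeal R)
    (hyc : RegOn c y) (hE : Submodule.colon (c ⊔ span {y}) ((K ⊔ span {y} : Ideal R) : Set R) ≤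
      Submodule.colon c (K : Set R) ⊔ span {y})
    (h : Submodule.colon (c ⊔ span {y})
      (Submodule.colon (c ⊔ span {y}) ((K ⊔ span {y} : Ideal R) : Set R) : Set R) ≤
        K ⊔ span {y}) :
    Submodule.colon c (Submodule.colon c (K : Set R) : Set R) ≤ K := by
  refine le_of_le_sup_span_mul hym fun a ha => ?_
  obtain ⟨t, ht⟩ := mem_sup_span_iff.1 (h (colon_anti hE (colon_sup_span_le (mem_sup_left ha))))
  refine ⟨t, hyc.colon _ t ?_, ht⟩
  simpa using sub_mem ha (le_colon_colon (c := c) ht)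

/-- Lifting duality statements along a regular sequence. -/
lemma lift_duality {c K : Ideal R} {l : List R} (hlm : ∀ a ∈ l, a ∈ maximalIdeal R)
    (hcK : c ≤ K) (hlc : RegSeq c l) (hlK : RegSeq K l)
    (hE : HomsPrincipal (c ⊔ ofList l) (K ⊔ ofList l))
    (hD : Submodule.colon (c ⊔ ofList l)
      (Submodule.colon (c ⊔ ofList l) ((K ⊔ ofList l : Ideal R) : Set R) : Set R) ≤
        K ⊔ ofList l) :
    HomsPrincipal c K ∧ Submodule.colon c (Submodule.colon c (K : Set R) : Set R) ≤ K ∧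
      RegSeq (Submodule.colon c (K : Set R)) l := by
  induction l generalizing c K with
  | nil => exact ⟨by simpa using hE, by simpa using hD, trivial⟩
  | cons y l ih =>
    simp only [List.mem_cons, forall_eq_or_imp] at hlm
    rw [ofList_cons, ← sup_assoc, ← sup_assoc] at hE hD
    obtain ⟨h1, h2, h3⟩ := ih hlm.2 (sup_le_sup_right hcK _) hlc.2 hlK.2 hE hD
    have h4 := h1.of_sup_span hlm.1 hcK hlc.1 hlK.1
    have h5 := h4.colon_sup_span hcK hlc.1
    refine ⟨h4, colon_colon_le_of_sup_span hlm.1 hlc.1 h5.le h2, hlc.1.colon _, ?_⟩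
    rwa [← h5]

lemma colon_le_of_sup_ofList {c K : Ideal R} {l : List R} (hlm : ∀ a ∈ l, a ∈ maximalIdeal R)
    (hlc : RegSeq c l) (h : Submodule.colon (c ⊔ ofList l) ((K ⊔ ofList l : Ideal R) : Set R) ≤
      c ⊔ ofList l) : Submodule.colon c (K : Set R) ≤ c := by
  induction l generalizing c K with
  | nil => simpa using h
  | cons y l ih =>
    simp only [List.mem_cons, forall_eq_or_imp] at hlm
    rw [ofList_cons, ← sup_assoc, ← sup_assoc] at h
    have h1 := ih hlm.2 hlc.2 h
    refine le_of_le_sup_span_mul hlm.1 fun a ha => ?_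
    obtain ⟨t, ht⟩ := mem_sup_span_iff.1 (h1 (colon_sup_span_le (mem_sup_left ha)))
    refine ⟨t, hlc.1.colon _ t ?_, ht⟩
    simpa using sub_mem ha (le_colon ht)

end

section

variable {R : Type*} [CommRing R] [IsLocalRing R]

lemma CMQuot.of_pow_le {K : Ideal R} (hK : K ≠ ⊤) {N : ℕ} (hN : maximalIdeal R ^ N ≤ K) :
    CMQuot K 0 := by
  refine ⟨hK, le_antisymm ?_ ?_, [], rfl, by simp, trivial⟩
  · refine Ring.krullDimLE_iff.1 (Ring.krullDimLE_zero_iff.2 fun P hP => ?_)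
    have hp : (P.comap (Ideal.Quotient.mk K)).IsPrime := hP.comap _
    have hKP : K ≤ P.comap (Ideal.Quotient.mk K) := fun x hx => by
      rw [mem_comap, Ideal.Quotient.eq_zero_iff_mem.2 hx]
      exact P.zero_mem
    have h1 : P.comap (Ideal.Quotient.mk K) = maximalIdeal R :=
      le_antisymm (le_maximalIdeal hp.ne_top) (hp.le_of_pow_le (hN.trans hKP))
    have h2 := map_comap_of_surjective _ Ideal.Quotient.mk_surjective P
    rw [h1] at h2
    exact h2 ▸ (map_eq_top_or_isMaximal_of_surjective _ Ideal.Quotient.mk_surjective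
      (maximalIdeal.isMaximal R)).resolve_left (h2 ▸ hP.ne_top)
  · have := Ideal.Quotient.nontrivial_iff.2 hK
    exact ringKrullDim_nonneg_of_nontrivial

variable [IsNoetherianRing R]

lemma CMQuot.of_sup_ofList {K : Ideal R} {n : ℕ} {l : List R} (hl : RegSeq K l)
    (hlm : ∀ a ∈ l, a ∈ maximalIdeal R) (h : CMQuot (K ⊔ ofList l) n) :
    CMQuot K (n + l.length) := by
  obtain ⟨l', hl'n, hl'm, hl'⟩ := h.seq
  refine ⟨fun hK => h.ne_top (by simp [hK]), ?_, l ++ l', by simp [hl'n, add_comm], ?_,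
    (regSeq_append _ _ _).2 ⟨hl, hl'⟩⟩
  · have hd := h.dim
    clear h hl'
    induction l generalizing K with
    | nil =>
      rw [ofList_nil, sup_bot_eq] at hd
      simpa using hd
    | cons a l ih =>
      simp only [List.mem_cons, forall_eq_or_imp] at hlm
      rw [← ringKrullDim_quotient_sup_span hl.1 hlm.1, ih hl.2 hlm.2
        (by rwa [ofList_cons, ← sup_assoc] at hd)]
      push_cast [List.length_cons]
      ring
  · simp only [List.mem_append]
    rintro a (ha | ha)
    exacts [hlm a ha, hl'm a ha]

variable {d : ℕ}

/-- Linkage by a complete intersection in a Gorenstein local ring. -/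
lemma GorLocal.duality (hG : GorLocal R d) {K : Ideal R} {n : ℕ} {l : List R}
    (hl : RegSeq ⊥ l) (hlm : ∀ a ∈ l, a ∈ maximalIdeal R) (hlK : ofList l ≤ K)
    (hK : CMQuot K n) (hn : n + l.length = d) :
    HomsPrincipal (ofList l) K ∧
      Submodule.colon (ofList l) (Submodule.colon (ofList l) (K : Set R) : Set R) = K ∧
      (Submodule.colon (ofList l) (K : Set R) ≠ ⊤ →
        CMQuot (Submodule.colon (ofList l) (K : Set R)) n) := by
  obtain ⟨n', hn', hc⟩ := hG.cm.sup_ofList hl hlm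
  obtain rfl : n = n' := by omega
  rw [bot_sup_eq] at hc
  obtain ⟨ys, hysn, hysm, hysc, hysK⟩ := CMQuot.exists_common (k := 0) hc hK
  obtain ⟨e, he, hq⟩ := hc.sup_ofList hysc hysm
  obtain rfl : e = 0 := by omega
  obtain ⟨N, hN⟩ := hq.pow_le
  have hlys : ∀ a ∈ l ++ ys, a ∈ maximalIdeal R := by
    simp only [List.mem_append]
    rintro a (ha | ha)
    exacts [hlm a ha, hysm a ha]
  have hsoc : HasSimpleSocle (ofList l ⊔ ofList ys) := by
    rw [← ofList_append]
    exact hG.socle _ (by simp; omega) hlys ((regSeq_append _ _ _).2 ⟨hl, by rwa [bot_sup_eq]⟩)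
  have hE : ∀ L, ofList l ⊔ ofList ys ≤ L → HomsPrincipal (ofList l ⊔ ofList ys) L :=
    fun L hL => hsoc.homsPrincipal hN hL
  have hle := sup_le_sup_right hlK (ofList ys)
  obtain ⟨h1, h2, h3⟩ := lift_duality hysm hlK hysc hysK (hE _ hle)
    (colon_colon_le_of_homsPrincipal hle (hasSocle_of_pow_le hq.ne_top hN) hE)
  refine ⟨h1, le_antisymm h2 le_colon_colon, fun hne => ?_⟩
  have := CMQuot.of_sup_ofList h3 hysm (CMQuot.of_pow_le
    (sup_ne_top hne (ofList_le.2 hysm)) (hN.trans (sup_le_sup_right le_colon _)))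
  rwa [zero_add, hysn] at this

/-- A directly linked Cohen-Macaulay ideal is linked by a complete intersection of the
complementary height. -/
lemma GorLocal.length_eq (hG : GorLocal R d) {K : Ideal R} {n : ℕ} {l : List R}
    (hl : RegSeq ⊥ l) (hlm : ∀ a ∈ l, a ∈ maximalIdeal R) (hlK : ofList l ≤ K)
    (hK : CMQuot K n)
    (hd : Submodule.colon (ofList l) (Submodule.colon (ofList l) (K : Set R) : Set R) = K) :
    n + l.length = d := by
  obtain ⟨e, he, hc⟩ := hG.cm.sup_ofList hl hlm
  rw [bot_sup_eq] at hc
  have hne : n ≤ e := by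
    have := ringKrullDim_le_of_surjective _ (Ideal.Quotient.factor_surjective hlK)
    rw [hK.dim, hc.dim] at this
    exact_mod_cast this
  obtain ⟨k, rfl⟩ := Nat.exists_eq_add_of_le hne
  rcases k with _ | k
  · omega
  exfalso
  obtain ⟨ys, hysn, hysm, hysc, hysK⟩ := CMQuot.exists_common hc hK
  obtain ⟨k', hk', hc'⟩ := hc.sup_ofList hysc hysm
  obtain rfl : k' = k + 1 := by omega
  obtain ⟨e', he', hK'⟩ := hK.sup_ofList hysK hysm
  obtain rfl : e' = 0 := by omega
  obtain ⟨N, hN⟩ := hK'.pow_le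
  obtain ⟨z, hzm, hz⟩ := hc'.exists_regOn
  have := colon_le_of_sup_ofList (K := K) hysm hysc fun a ha => hz.pow N _ (by
    rw [mul_comm]
    exact mem_colon_ideal.1 ha _ (hN (pow_mem_pow hzm N)))
  rw [le_antisymm this le_colon, colon_self] at hd
  exact hK.ne_top hd.symm

end

open Polynomial

section

variable {R : Type*} [CommRing R] [IsLocalRing R]

/-- The filter of cofinite sets of residue classes. -/
noncomputable def almostAll (R : Type*) [CommRing R] [IsLocalRing R] : Filter R :=
  Filter.comap (residue R) Filter.cofinite

instance [Infinite (ResidueField R)] : (almostAll R).NeBot :=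
  Filter.NeBot.comap_of_surj inferInstance residue_surjective

lemma eventually_almostAll {p : R → Prop} {s : Set (ResidueField R)} (hs : s.Finite)
    (h : ∀ a, ¬ p a → residue R a ∈ s) : ∀ᶠ a in almostAll R, p a := by
  rw [almostAll, Filter.eventually_comap, Filter.eventually_cofinite]
  refine hs.subset fun b hb => ?_
  simp only [Set.mem_ofPred_eq, not_forall] at hb
  obtain ⟨a, rfl, ha⟩ := hb
  exact h a ha

lemma eventually_isUnit_sub (b : R) : ∀ᶠ a in almostAll R, IsUnit (a - b) := by
  refine eventually_almostAll (Set.finite_singleton (residue R b)) fun a ha => ?_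
  rw [Set.mem_singleton_iff, ← sub_eq_zero, ← map_sub, residue_eq_zero_iff]
  exact ha

lemma eventually_isUnit_eval {s : R[X]} (h : IsUnit (s.eval 0)) :
    ∀ᶠ a in almostAll R, IsUnit (s.eval a) := by
  refine eventually_almostAll (Polynomial.rootSet_finite (s.map (residue R)) (ResidueField R))
    fun a ha => ?_
  have h0 : s.map (residue R) ≠ 0 := fun h' => by
    have := (h.map (residue R)).ne_zero
    rw [← eval_map_apply, map_zero, h', eval_zero] at this
    exact this rfl
  rw [mem_rootSet, aeval_def, Algebra.algebraMap_self, eval₂_id, eval_map_apply]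
  exact ⟨h0, (residue_eq_zero_iff _).2 ha⟩

lemma eq_zero_of_eventually_eval [Infinite (ResidueField R)] (L : Ideal R) (n : ℕ)
    (f : (R ⧸ L)[X]) (hn : f.natDegree ≤ n)
    (h : ∀ᶠ a in almostAll R, f.eval (Ideal.Quotient.mk L a) = 0) : f = 0 := by
  nontriviality R ⧸ L
  induction n generalizing f with
  | zero =>
    obtain ⟨a, ha⟩ := h.exists
    rw [eq_C_of_natDegree_le_zero hn, eval_C] at ha
    rw [eq_C_of_natDegree_le_zero hn, ha, C_0]
  | succ n ih =>
    obtain ⟨b, hb⟩ := h.exists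
    have hf := mul_divByMonic_eq_iff_isRoot.2 hb
    have : f /ₘ (X - C (Ideal.Quotient.mk L b)) = 0 := by
      refine ih _ ?_ ?_
      · rw [natDegree_divByMonic f (monic_X_sub_C _), natDegree_X_sub_C]
        omega
      · filter_upwards [h, eventually_isUnit_sub b] with a ha hab
        rw [← hf, eval_mul, eval_sub, eval_X, eval_C, ← map_sub] at ha
        exact (hab.map (Ideal.Quotient.mk L)).mul_right_eq_zero.1 ha
    rw [← hf, this, mul_zero]

lemma eval_zero_mem_of_eventually [Infinite (ResidueField R)] {L : Ideal R} {f : R[X]}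
    (h : ∀ᶠ a in almostAll R, f.eval a ∈ L) : f.eval 0 ∈ L := by
  have := eq_zero_of_eventually_eval L _ (f.map (Ideal.Quotient.mk L)) le_rfl (by
    filter_upwards [h] with a ha
    rwa [eval_map_apply, Ideal.Quotient.eq_zero_iff_mem])
  rw [← Ideal.Quotient.eq_zero_iff_mem, ← eval_map_apply, this, eval_zero]

lemma eventually_regOn_X_sub_C [IsNoetherianRing R] (Q : Ideal R[X]) :
    ∀ᶠ a in almostAll R, RegOn Q (X - C a) := by
  have : ∀ᶠ a in almostAll R, ∀ p ∈ associatedPrimes R[X] (R[X] ⧸ Q), X - C a ∉ p := by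
    rw [Filter.eventually_all_finite (associatedPrimes.finite R[X] (R[X] ⧸ Q))]
    intro p hp
    by_cases h : ∃ b, X - C b ∈ p
    · obtain ⟨b, hb⟩ := h
      filter_upwards [eventually_isUnit_sub b] with a ha ha'
      refine hp.isPrime.ne_top (p.eq_top_of_isUnit_mem ?_ (ha.map C))
      convert p.sub_mem hb ha' using 1
      rw [C_sub]
      ring
    · push Not at h
      exact Filter.Eventually.of_forall h
  filter_upwards [this] with a ha
  by_contra h
  obtain ⟨p, hp, hap⟩ := Set.mem_iUnion₂.1 ((biUnion_associatedPrimes Q _).2 h)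
  exact ha p hp hap

end

section

variable {S : Type*} [CommRing S]

lemma exists_notMem_forall_mul_mem [IsNoetherianRing S] {p : Ideal S} [hp : p.IsPrime]
    {K Q : Ideal S} (h : ∀ r ∈ K, ∃ s ∉ p, s * r ∈ Q) : ∃ s ∉ p, ∀ r ∈ K, s * r ∈ Q := by
  classical
  obtain ⟨t, rfl⟩ := (isNoetherianRing_iff_ideal_fg S).1 ‹_› K
  choose! s hs using fun r (hr : r ∈ t) => h r (subset_span hr)
  refine ⟨∏ r ∈ t, s r, fun hm => ?_, fun r hr => ?_⟩
  · obtain ⟨r, hr, hm⟩ := (hp.prod_mem_iff).1 hm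
    exact (hs r hr).1 hm
  · induction hr using Submodule.span_induction with
    | mem r hr =>
      rw [← Finset.prod_erase_mul t s hr, mul_assoc]
      exact Q.mul_mem_left _ (hs r hr).2
    | zero => simp
    | add x y _ _ hx hy => rw [mul_add]; exact Q.add_mem hx hy
    | smul c x _ hx => rw [smul_eq_mul, mul_left_comm]; exact Q.mul_mem_left _ hx

variable (p : Ideal S) [hp : p.IsPrime]

lemma algebraMap_mem_map_iff {Q : Ideal S} {x : S} :
    algebraMap S (Localization.AtPrime p) x ∈ Q.map (algebraMap S (Localization.AtPrime p)) ↔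
      ∃ s ∉ p, s * x ∈ Q := by
  rw [IsLocalization.algebraMap_mem_map_algebraMap_iff p.primeCompl]
  rfl

lemma exists_isUnit_mul_eq (y : Localization.AtPrime p) :
    ∃ u x, IsUnit u ∧ u * y = algebraMap S (Localization.AtPrime p) x := by
  obtain ⟨⟨x, s⟩, h⟩ := IsLocalization.surj p.primeCompl y
  exact ⟨_, x, IsLocalization.map_units _ s, by rw [mul_comm]; exact h⟩

lemma regOn_map_iff [IsNoetherianRing S] {Q : Ideal S} {b : S} :
    RegOn (Q.map (algebraMap S (Localization.AtPrime p)))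
      (algebraMap S (Localization.AtPrime p) b) ↔ ∃ s ∉ p, ∀ r, b * r ∈ Q → s * r ∈ Q := by
  constructor
  · intro h
    obtain ⟨s, hs, H⟩ := exists_notMem_forall_mul_mem (p := p) (Q := Q)
      (K := Submodule.colon Q ((span {b} : Ideal S) : Set S)) (fun r hr => by
        rw [← algebraMap_mem_map_iff]
        refine h _ ?_
        rw [← map_mul]
        rw [mul_comm]
        exact mem_map_of_mem _ (mem_colon_ideal.1 hr b (mem_span_singleton_self b)))
    refine ⟨s, hs, fun r hr => H r (mem_colon_ideal.2 fun y hy => ?_)⟩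
    obtain ⟨c, rfl⟩ := mem_span_singleton'.1 hy
    convert Q.mul_mem_left c hr using 1
    ring
  · rintro ⟨s, hs, H⟩ y hy
    obtain ⟨u, x, hu, hx⟩ := exists_isUnit_mul_eq p y
    rw [← unit_mul_mem_iff_mem _ hu, mul_left_comm, hx, ← map_mul] at hy
    rw [← unit_mul_mem_iff_mem _ hu, hx]
    obtain ⟨t, ht, H'⟩ := (algebraMap_mem_map_iff p).1 hy
    refine (algebraMap_mem_map_iff p).2 ⟨s * t, fun h => (hp.mem_or_mem h).elim hs ht, ?_⟩
    rw [mul_assoc]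
    refine H _ ?_
    convert H' using 1
    ring

lemma RegOn.localize [IsNoetherianRing S] {Q : Ideal S} {b : S} (h : RegOn Q b) :
    RegOn (Q.map (algebraMap S (Localization.AtPrime p)))
      (algebraMap S (Localization.AtPrime p) b) :=
  (regOn_map_iff p).2 ⟨1, p.ne_top_iff_one.1 hp.ne_top, fun r hr => by simpa using h r hr⟩

lemma map_colon_localization [IsNoetherianRing S] (c K : Ideal S) :
    (Submodule.colon c (K : Set S)).map (algebraMap S (Localization.AtPrime p)) =
      Submodule.colon (c.map (algebraMap S (Localization.AtPrime p)))
        (K.map (algebraMap S (Localization.AtPrime p)) : Set (Localization.AtPrime p)) := by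
  refine le_antisymm ?_ fun y hy => ?_
  · rw [map_le_iff_le_comap]
    intro x hx
    rw [mem_comap, mem_colon_ideal]
    intro y hy
    have : K.map (algebraMap S (Localization.AtPrime p)) ≤
        Submodule.colon (c.map (algebraMap S (Localization.AtPrime p)))
          (span {algebraMap S (Localization.AtPrime p) x} : Set (Localization.AtPrime p)) := by
      rw [map_le_iff_le_comap]
      intro k hk
      rw [mem_comap, mem_colon_ideal]
      intro z hz
      obtain ⟨w, rfl⟩ := mem_span_singleton'.1 hz
      rw [mul_left_comm, ← map_mul, mul_comm k]
      exact Ideal.mul_mem_left _ _ (mem_map_of_mem _ (mem_colon_ideal.1 hx k hk))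
    rw [mul_comm]
    exact mem_colon_ideal.1 (this hy) _ (mem_span_singleton_self _)
  · obtain ⟨u, x, hu, hx⟩ := exists_isUnit_mul_eq p y
    rw [← unit_mul_mem_iff_mem _ hu] at hy ⊢
    rw [hx] at hy ⊢
    rw [mem_colon_ideal] at hy
    obtain ⟨s, hs, H⟩ := exists_notMem_forall_mul_mem (p := p) (Q := c) (K := span {x} * K)
      fun z hz => by
        obtain ⟨r, hr, rfl⟩ := mem_span_singleton_mul.1 hz
        rw [← algebraMap_mem_map_iff, map_mul]
        exact hy _ (mem_map_of_mem _ hr)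
    refine (algebraMap_mem_map_iff p).2 ⟨s, hs, mem_colon_ideal.2 fun r hr => ?_⟩
    rw [mul_assoc]
    exact H _ (mem_span_singleton_mul.2 ⟨r, hr, rfl⟩)

end

section

variable {A R : Type*} [CommRing A] [IsLocalRing A] [IsNoetherianRing A] [CommRing R]
  {ψ : A →+* R} {T : A} {f : List A}

lemma RegSeq.lift (hψ : Function.Surjective ψ) (hker : RingHom.ker ψ = span {T})
    (hTm : T ∈ maximalIdeal A) (hT : RegOn ⊥ T) (hfm : ∀ a ∈ f, a ∈ maximalIdeal A)
    (hf : RegSeq ⊥ (f.map ψ)) : RegSeq ⊥ f ∧ RegOn (ofList f) T := by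
  rw [← regSeq_comap_iff hψ, ← RingHom.ker_eq_comap_bot, hker] at hf
  have : RegSeq ⊥ (f ++ [T]) := by
    refine RegSeq.perm (l := T :: f) ⟨hT, by rwa [bot_sup_eq]⟩
      (List.perm_append_singleton T f).symm ?_
    simpa using ⟨hTm, hfm⟩
  obtain ⟨h1, h2⟩ := (regSeq_append _ _ _).1 this
  exact ⟨h1, by simpa using h2.1⟩

lemma RegSeq.specialize (hψ : Function.Surjective ψ) (hker : RingHom.ker ψ = span {T})
    (hTm : T ∈ maximalIdeal A) (hfm : ∀ a ∈ f, a ∈ maximalIdeal A)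
    (hf : RegSeq ⊥ f) (hT : RegOn (ofList f) T) : RegSeq ⊥ (f.map ψ) := by
  rw [← regSeq_comap_iff hψ, ← RingHom.ker_eq_comap_bot, hker]
  have := (hf.rotate (by rwa [bot_sup_eq]) hfm hTm).2
  rwa [bot_sup_eq] at this

lemma map_colon_eq (hψ : Function.Surjective ψ) (hker : RingHom.ker ψ = span {T})
    (hTm : T ∈ maximalIdeal A) (hTf : RegOn (ofList f) T) {K : Ideal A} (hfK : ofList f ≤ K)
    (hTK : RegOn K T) (h : HomsPrincipal (ofList (f.map ψ)) (K.map ψ)) :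
    (Submodule.colon (ofList f) (K : Set A)).map ψ =
      Submodule.colon (ofList (f.map ψ)) (K.map ψ : Set R) := by
  have hmap : ∀ J : Ideal A, (J.map ψ).comap ψ = J ⊔ span {T} := fun J => by
    rw [comap_map_of_surjective' ψ hψ, hker]
  rw [← map_ofList] at h ⊢
  have h1 := h.comap hψ (map_mono hfK)
  rw [hmap, hmap] at h1
  have h2 := (h1.of_sup_span hTm hfK hTf hTK).colon_sup_span hfK hTf
  rw [← hmap, ← hmap, ← hmap] at h2
  refine (comap_injective_of_surjective ψ hψ) ?_
  rw [← h2]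
  ext x
  rw [mem_comap, mem_colon_ideal, mem_colon_ideal]
  simp only [mem_comap, map_mul]
  exact ⟨fun h s hs => by obtain ⟨s, rfl⟩ := hψ s; exact h s hs, fun h s hs => h _ hs⟩

end

section

variable {R : Type*} [CommRing R] [IsLocalRing R]

/-- The polynomials whose value at `a` is a nonunit. -/
noncomputable abbrev evalIdeal (a : R) : Ideal R[X] := (maximalIdeal R).comap (evalRingHom a)

/-- The local ring of `R[X]` at the closed point of the section `X = a`. -/
abbrev EvalLoc (a : R) : Type _ := Localization.AtPrime (evalIdeal a)

/-- Evaluation at `a` on `EvalLoc a`. -/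
noncomputable def evalLift (a : R) : EvalLoc a →+* R :=
  IsLocalization.lift (M := (evalIdeal a).primeCompl) (g := evalRingHom a) fun s => by
    by_contra h
    exact s.2 h

lemma evalLift_algebraMap (a : R) (f : R[X]) :
    evalLift a (algebraMap R[X] (EvalLoc a) f) = f.eval a :=
  IsLocalization.lift_eq _ f

lemma evalLift_comp (a : R) :
    (evalLift a).comp (algebraMap R[X] (EvalLoc a)) = evalRingHom a :=
  RingHom.ext (evalLift_algebraMap a)

lemma evalLift_surjective (a : R) : Function.Surjective (evalLift a) := fun r =>
  ⟨algebraMap R[X] (EvalLoc a) (C r), by rw [evalLift_algebraMap, eval_C]⟩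

lemma ker_evalLift (a : R) :
    RingHom.ker (evalLift a) = span {algebraMap R[X] (EvalLoc a) (X - C a)} := by
  refine le_antisymm (fun y hy => ?_) ((span_singleton_le_iff_mem _).2 ?_)
  · obtain ⟨u, x, hu, hx⟩ := exists_isUnit_mul_eq (evalIdeal a) y
    rw [← unit_mul_mem_iff_mem _ hu] at hy ⊢
    rw [hx] at hy ⊢
    rw [RingHom.mem_ker, evalLift_algebraMap] at hy
    exact mem_span_singleton.2 (map_dvd _ (dvd_iff_isRoot.2 hy))
  · rw [RingHom.mem_ker, evalLift_algebraMap]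
    simp

lemma algebraMap_mem_maximalIdeal {a : R} {f : R[X]} :
    algebraMap R[X] (EvalLoc a) f ∈ maximalIdeal (EvalLoc a) ↔ f.eval a ∈ maximalIdeal R :=
  IsLocalization.AtPrime.to_map_mem_maximal_iff _ (evalIdeal a) f

lemma map_evalLift (a : R) (K : Ideal R[X]) :
    (K.map (algebraMap R[X] (EvalLoc a))).map (evalLift a) = K.map (evalRingHom a) := by
  rw [Ideal.map_map, evalLift_comp]

lemma map_evalLift_map (a : R) (f : List R[X]) :
    (f.map (algebraMap R[X] (EvalLoc a))).map (evalLift a) = f.map (eval a) := by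
  rw [List.map_map]
  exact List.map_congr_left fun g _ => evalLift_algebraMap a g

/-- `X - a` is a nonzerodivisor modulo `K` near the closed point of the section `X = a`. -/
def FlatAt (K : Ideal R[X]) (a : R) : Prop :=
  RegOn (K.map (algebraMap R[X] (EvalLoc a))) (algebraMap R[X] (EvalLoc a) (X - C a))

variable [IsNoetherianRing R]

lemma eventually_flatAt (K : Ideal R[X]) : ∀ᶠ a in almostAll R, FlatAt K a := by
  filter_upwards [eventually_regOn_X_sub_C K] with a ha
  exact ha.localize _

lemma flatAt_bot (a : R) : FlatAt (⊥ : Ideal R[X]) a :=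
  RegOn.localize _ fun r hr => by
    rw [mem_bot] at hr ⊢
    exact (monic_X_sub_C a).mul_right_eq_zero_iff.1 hr

lemma eventually_regSeq_localization (Q : Ideal R[X]) (f : List R[X])
    (h : RegSeq (Q.map (algebraMap R[X] (EvalLoc (0 : R))))
      (f.map (algebraMap R[X] (EvalLoc (0 : R))))) :
    ∀ᶠ a in almostAll R, RegSeq (Q.map (algebraMap R[X] (EvalLoc a)))
      (f.map (algebraMap R[X] (EvalLoc a))) := by
  induction f generalizing Q with
  | nil => exact Filter.Eventually.of_forall fun _ => trivial
  | cons g f ih =>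
    have hspan : ∀ a : R, (Q ⊔ span {g}).map (algebraMap R[X] (EvalLoc a)) =
        Q.map (algebraMap R[X] (EvalLoc a)) ⊔ span {algebraMap R[X] (EvalLoc a) g} := fun a => by
      rw [Ideal.map_sup, map_span, Set.image_singleton]
    obtain ⟨s, hs, H⟩ := (regOn_map_iff _).1 h.1
    have hs : IsUnit (s.eval 0) := by simpa using hs
    filter_upwards [eventually_isUnit_eval hs, ih _ (by rw [hspan]; exact h.2)] with a ha hf
    exact ⟨(regOn_map_iff _).2 ⟨s, by simpa using ha, H⟩, by rw [← hspan]; exact hf⟩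

lemma regSeq_localization {f : List R[X]} {a : R} (hfm : ∀ g ∈ f, g.eval a ∈ maximalIdeal R)
    (hf : RegSeq ⊥ (f.map (eval a))) :
    RegSeq ⊥ (f.map (algebraMap R[X] (EvalLoc a))) ∧
      RegOn (ofList (f.map (algebraMap R[X] (EvalLoc a))))
        (algebraMap R[X] (EvalLoc a) (X - C a)) := by
  refine RegSeq.lift (evalLift_surjective a) (ker_evalLift a)
    (algebraMap_mem_maximalIdeal.2 (by simp)) ?_ ?_ ?_
  · simpa [FlatAt] using flatAt_bot a
  · exact List.forall_mem_map.2 fun g hg => algebraMap_mem_maximalIdeal.2 (hfm g hg)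
  · rwa [map_evalLift_map]

lemma eventually_regSeq_eval {f : List R[X]} (hfm : ∀ g ∈ f, g.eval 0 ∈ maximalIdeal R)
    (hf : RegSeq ⊥ (f.map (eval 0))) :
    ∀ᶠ a in almostAll R, (∀ g ∈ f, g.eval a ∈ maximalIdeal R) →
      RegSeq ⊥ (f.map (eval a)) := by
  filter_upwards [eventually_regSeq_localization ⊥ f
    (by simpa using (regSeq_localization hfm hf).1), eventually_flatAt (ofList f)] with a ha hT hm
  rw [← map_evalLift_map]
  refine RegSeq.specialize (evalLift_surjective a) (ker_evalLift a)
    (algebraMap_mem_maximalIdeal.2 (by simp)) ?_ (by simpa using ha) ?_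
  · exact List.forall_mem_map.2 fun g hg => algebraMap_mem_maximalIdeal.2 (hm g hg)
  · rw [← map_ofList]
    exact hT

lemma FlatAt.colon {K : Ideal R[X]} {f : List R[X]} {a : R} (hK : FlatAt K a)
    (hfK : ofList f ≤ K) (hfm : ∀ g ∈ f, g.eval a ∈ maximalIdeal R)
    (hf : RegSeq ⊥ (f.map (eval a)))
    (h : HomsPrincipal (ofList (f.map (eval a))) (K.map (evalRingHom a))) :
    FlatAt (Submodule.colon (ofList f) (K : Set R[X])) a ∧
      (Submodule.colon (ofList f) (K : Set R[X])).map (evalRingHom a) =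
        Submodule.colon (ofList (f.map (eval a))) (K.map (evalRingHom a) : Set R) := by
  have hT := (regSeq_localization hfm hf).2
  have hcol := map_colon_localization (evalIdeal a) (ofList f) K
  refine ⟨?_, ?_⟩
  · rw [FlatAt, hcol, map_ofList]
    exact hT.colon _
  · rw [← map_evalLift, hcol, map_ofList]
    have := map_colon_eq (evalLift_surjective a) (ker_evalLift a)
      (algebraMap_mem_maximalIdeal.2 (by simp)) hT
      (by rw [← map_ofList]; exact map_mono hfK) hK
      (by rwa [map_evalLift_map, map_evalLift])
    rwa [map_evalLift_map, map_evalLift] at this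

end

section

variable {R : Type} [CommRing R]

lemma isDirectlyLinked_symm {I J : Ideal R} (h : IsDirectlyLinked R I J) :
    IsDirectlyLinked R J I := by
  obtain ⟨hI, hJ, c, hc, hle, h1, h2⟩ := h
  exact ⟨hJ, hI, c, hc, by rwa [inf_comm], h2, h1⟩

lemma linkedInSteps_trans {j k : ℕ} {I J K : Ideal R} (h : LinkedInSteps R j I J)
    (h' : LinkedInSteps R k J K) : LinkedInSteps R (j + k) I K := by
  induction j generalizing I with
  | zero =>
    obtain rfl : I = J := h
    rwa [Nat.zero_add]
  | succ j ih =>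
    obtain ⟨I', hI, h⟩ := h
    rw [Nat.succ_add]
    exact ⟨I', hI, ih h⟩

lemma linkedInSteps_symm {k : ℕ} {I J : Ideal R} (h : LinkedInSteps R k I J) :
    LinkedInSteps R k J I := by
  induction k generalizing I with
  | zero => exact Eq.symm h
  | succ k ih =>
    obtain ⟨I', hI, h⟩ := h
    exact linkedInSteps_trans (j := k) (k := 1) (ih h) ⟨I, isDirectlyLinked_symm hI, rfl⟩

lemma exists_linkedInSteps {I J : Ideal R} (h : InSameLinkageClass R I J) :
    ∃ k, LinkedInSteps R k I J := by
  induction h with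
  | rel I J h => exact ⟨1, J, h, rfl⟩
  | refl I => exact ⟨0, rfl⟩
  | symm I J _ ih => exact ih.imp fun _ => linkedInSteps_symm
  | trans I J K _ _ ih ih' =>
    obtain ⟨j, hj⟩ := ih
    obtain ⟨k, hk⟩ := ih'
    exact ⟨j + k, linkedInSteps_trans hj hk⟩

lemma ne_top_of_linkedInSteps {k : ℕ} {I J : Ideal R} (hI : I ≠ ⊤) (h : LinkedInSteps R k I J) :
    J ≠ ⊤ := by
  induction k generalizing I with
  | zero => exact (h : I = J) ▸ hI
  | succ k ih =>
    obtain ⟨I', hI', h⟩ := h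
    exact ih hI'.2.1 h

lemma colon_sup_span_mul {c : Ideal R} {a : R} (ha : RegOn c a) (b : R) :
    Submodule.colon (c ⊔ span {a * b}) ((c ⊔ span {a} : Ideal R) : Set R) = c ⊔ span {b} := by
  refine le_antisymm (fun r hr => ?_) (sup_le (le_sup_left.trans le_colon)
    ((span_singleton_le_iff_mem _).2 (mem_colon_ideal.2 fun s hs => ?_)))
  · obtain ⟨t, ht⟩ := mem_sup_span_iff.1 (mem_colon_sup_span.1 hr).2
    refine mem_sup_span_iff.2 ⟨t, ha _ ?_⟩
    convert ht using 1
    ring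
  · obtain ⟨t, ht⟩ := mem_sup_span_iff.1 hs
    refine mem_sup_span_iff.2 ⟨t, ?_⟩
    convert c.mul_mem_left b ht using 1
    ring

lemma isDirectlyLinked_of_colon_eq {I J : Ideal R} {l : List R} (hI : I ≠ ⊤) (hJ : J ≠ ⊤)
    (hl : RegSeq ⊥ l) (hlI : ofList l ≤ I) (h1 : Submodule.colon (ofList l) (J : Set R) = I)
    (h2 : Submodule.colon (ofList l) (I : Set R) = J) : IsDirectlyLinked R I J := by
  have hne : ofList l ≠ ⊤ := fun h => hI (top_le_iff.1 (h ▸ hlI))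
  exact ⟨hI, hJ, ofList l, ⟨hne, l, (isRegular_iff_regSeq l).2 ⟨hl, hne⟩, rfl⟩,
    le_inf hlI (h2 ▸ le_colon), h1, h2⟩

lemma eq_of_colon_eq_top {c K : Ideal R} (hcK : c ≤ K)
    (h : Submodule.colon c (K : Set R) = ⊤) : K = c :=
  le_antisymm (fun x hx => by simpa using mem_colon_ideal.1 (h ▸ trivial : (1 : R) ∈ _) x hx) hcK

lemma exists_list_lift {K : Ideal R[X]} {a : R} {l : List R}
    (h : ofList l ≤ K.map (evalRingHom a)) :
    ∃ f : List R[X], f.map (eval a) = l ∧ ofList f ≤ K := by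
  have hs : Function.Surjective (evalRingHom a) := fun r => ⟨C r, by simp⟩
  induction l with
  | nil => exact ⟨[], rfl, by simp⟩
  | cons b l ih =>
    rw [ofList_cons, sup_le_iff, span_singleton_le_iff_mem, mem_map_iff_of_surjective _ hs] at h
    obtain ⟨⟨g, hg, rfl⟩, h⟩ := h
    obtain ⟨f, rfl, hf⟩ := ih h
    exact ⟨g :: f, rfl, by
      rw [ofList_cons, sup_le_iff, span_singleton_le_iff_mem]; exact ⟨hg, hf⟩⟩

lemma ofList_map_eval_le {K : Ideal R[X]} (a : R) {f : List R[X]} (hf : ofList f ≤ K) :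
    ofList (f.map (eval a)) ≤ K.map (evalRingHom a) :=
  ofList_le.2 (List.forall_mem_map.2 fun _ hg => mem_map_of_mem (evalRingHom a)
    (hf (mem_ofList hg)))

variable [IsLocalRing R]

lemma eval_mem_maximalIdeal {K : Ideal R[X]} {a : R} (hK : K.map (evalRingHom a) ≠ ⊤)
    {f : List R[X]} (hf : ofList f ≤ K) : ∀ g ∈ f, g.eval a ∈ maximalIdeal R := fun _ hg =>
  le_maximalIdeal hK (mem_map_of_mem (evalRingHom a) (hf (mem_ofList hg)))

lemma exists_of_isDirectlyLinked {I J : Ideal R} (h : IsDirectlyLinked R I J) :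
    ∃ l : List R, RegSeq ⊥ l ∧ (∀ a ∈ l, a ∈ maximalIdeal R) ∧ ofList l ≤ I ∧
      Submodule.colon (ofList l) (J : Set R) = I ∧
      Submodule.colon (ofList l) (I : Set R) = J := by
  obtain ⟨hI, -, _, ⟨hne, l, hl, rfl⟩, hle, h1, h2⟩ := h
  exact ⟨l, ((isRegular_iff_regSeq l).1 hl).1,
    ofList_le.1 (le_maximalIdeal hne), le_inf_iff.1 hle |>.1, h1, h2⟩

lemma isDirectlyLinked_sup_span {l : List R} (hl : RegSeq ⊥ l)
    (hlm : ∀ a ∈ l, a ∈ maximalIdeal R) {a b : R} (ha : RegOn (ofList l) a)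
    (hb : RegOn (ofList l) b) (ham : a ∈ maximalIdeal R) (hbm : b ∈ maximalIdeal R) :
    IsDirectlyLinked R (ofList l ⊔ span {a}) (ofList l ⊔ span {b}) := by
  have hne : ∀ c ∈ maximalIdeal R, ofList l ⊔ span {c} ≠ ⊤ := fun c hc h =>
    (maximalIdeal.isMaximal R).ne_top (top_le_iff.1 (h ▸ sup_le (ofList_le.2 hlm)
      ((span_singleton_le_iff_mem _).2 hc)))
  have hof : ofList (l ++ [a * b]) = ofList l ⊔ span {a * b} := by
    rw [ofList_append, ofList_singleton]
  refine isDirectlyLinked_of_colon_eq (l := l ++ [a * b]) (hne a ham) (hne b hbm)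
    ((regSeq_append _ _ _).2 ⟨hl, by simpa using ha.mul hb, trivial⟩) ?_ ?_ ?_
  · rw [hof]
    exact sup_le_sup_left (span_singleton_le_span_singleton.2 (Dvd.intro _ rfl)) _
  · rw [hof, mul_comm, colon_sup_span_mul hb]
  · rw [hof, colon_sup_span_mul ha]

variable [IsNoetherianRing R]

/-- The ideals directly linked to a complete intersection of positive height generate the maximal
ideal. -/
lemma maximalIdeal_le_of_ofList {l : List R} (hne : l ≠ []) (hl : RegSeq ⊥ l)
    (hlm : ∀ a ∈ l, a ∈ maximalIdeal R) {L : Ideal R}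
    (h : ∀ J, IsDirectlyLinked R (ofList l) J → J ≤ L) : maximalIdeal R ≤ L := by
  obtain ⟨l, a, rfl⟩ := List.eq_nil_or_concat' l |>.resolve_left hne
  obtain ⟨hl, ha⟩ := (regSeq_append _ _ _).1 hl
  replace ha : RegOn (ofList l) a := by simpa using ha.1
  rw [List.forall_mem_append, List.forall_mem_singleton] at hlm
  by_contra hL
  obtain ⟨b, hb, hbL, H⟩ := exists_regOn_notMem (maximalIdeal R) L [ofList l]
    (by simpa using ⟨a, hlm.2, ha⟩) hL
  have := isDirectlyLinked_sup_span hl hlm.1 ha (H _ (by simp)) hlm.2 hb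
  rw [← ofList_singleton a, ← ofList_append] at this
  exact hbL (h _ this (mem_sup_right (mem_span_singleton_self b)))

variable {d : ℕ}

lemma GorLocal.isDirectlyLinked (hG : GorLocal R d) {K : Ideal R} {n : ℕ} {l : List R}
    (hl : RegSeq ⊥ l) (hlm : ∀ a ∈ l, a ∈ maximalIdeal R) (hlK : ofList l ≤ K)
    (hK : CMQuot K n) (hn : n + l.length = d) (hne : Submodule.colon (ofList l) (K : Set R) ≠ ⊤) :
    IsDirectlyLinked R K (Submodule.colon (ofList l) (K : Set R)) :=
  isDirectlyLinked_of_colon_eq hK.ne_top hne hl hlK (hG.duality hl hlm hlK hK hn).2.1 rfl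

variable [Infinite (ResidueField R)]

/-- Linkage in `k` steps specializes from general fibers to the fiber over `0`. -/
lemma GorLocal.le_of_eventually_le (hG : GorLocal R d) {L : Ideal R}
    (hL : ¬ maximalIdeal R ≤ L) {n : ℕ} (hn : n < d) (k : ℕ) {K : Ideal R[X]}
    (hflat : FlatAt K 0) (hK0 : CMQuot (K.map (evalRingHom 0)) n)
    (hK : ∀ᶠ a in almostAll R, CMQuot (K.map (evalRingHom a)) n)
    (h : ∀ᶠ a in almostAll R, ∀ j ≤ k, ∀ J, LinkedInSteps R j (K.map (evalRingHom a)) J → J ≤ L)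
    {J : Ideal R} (hJ : LinkedInSteps R k (K.map (evalRingHom 0)) J) : J ≤ L := by
  induction k generalizing K with
  | zero =>
    obtain rfl : _ = J := hJ
    rw [map_le_iff_le_comap]
    intro f hf
    refine eval_zero_mem_of_eventually ?_
    filter_upwards [h] with a ha
    exact ha 0 le_rfl _ rfl (mem_map_of_mem (evalRingHom a) hf)
  | succ k ih =>
    obtain ⟨J₁, hlink, hJ⟩ := hJ
    obtain ⟨l, hl, hlm, hlK, h1, h2⟩ := exists_of_isDirectlyLinked hlink
    have hlen := hG.length_eq hl hlm hlK hK0 (by rw [h2, h1])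
    obtain ⟨hP, -, hCM⟩ := hG.duality hl hlm hlK hK0 hlen
    obtain ⟨f, rfl, hfK⟩ := exists_list_lift hlK
    rw [List.length_map] at hlen
    have hf0 := eval_mem_maximalIdeal hK0.ne_top hfK
    obtain ⟨hflat', hmap⟩ := hflat.colon hfK hf0 hl hP
    have hJ₁ := hmap.trans h2
    have key : ∀ᶠ a in almostAll R,
        CMQuot ((Submodule.colon (ofList f) (K : Set R[X])).map (evalRingHom a)) n ∧
        IsDirectlyLinked R (K.map (evalRingHom a))
          ((Submodule.colon (ofList f) (K : Set R[X])).map (evalRingHom a)) := by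
      filter_upwards [hK, h, eventually_regSeq_eval hf0 hl, eventually_flatAt K]
        with a hKa ha hfa hflat
      have hfm := eval_mem_maximalIdeal hKa.ne_top hfK
      have hfm' : ∀ b ∈ f.map (eval a), b ∈ maximalIdeal R := List.forall_mem_map.2 hfm
      have hle := ofList_map_eval_le a hfK
      have hlen' : n + (f.map (eval a)).length = d := by rwa [List.length_map]
      obtain ⟨hP, -, hCM⟩ := hG.duality (hfa hfm) hfm' hle hKa hlen'
      have hne : Submodule.colon (ofList (f.map (eval a))) (K.map (evalRingHom a) : Set R) ≠ ⊤ := by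
        intro htop
        rw [eq_of_colon_eq_top hle htop] at ha
        refine hL (maximalIdeal_le_of_ofList ?_ (hfa hfm) hfm' fun J hJ =>
          ha 1 (Nat.succ_le_succ (Nat.zero_le k)) J ⟨J, hJ, rfl⟩)
        rintro h0
        rw [h0, List.length_nil] at hlen'
        omega
      rw [(hflat.colon hfK hfm (hfa hfm) hP).2]
      exact ⟨hCM hne, hG.isDirectlyLinked (hfa hfm) hfm' hle hKa hlen' hne⟩
    refine ih hflat' ?_ (key.mono fun _ h => h.1) ?_ (by rwa [hJ₁])
    · rw [hJ₁, ← h2]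
      exact hCM (h2 ▸ hlink.2.1)
    · filter_upwards [h, key] with a ha hlink j hj J hJ
      exact ha (j + 1) (Nat.succ_le_succ hj) J ⟨_, hlink.2, hJ⟩

end

section

variable {R : Type} [CommRing R]

lemma map_C_map_evalRingHom (K : Ideal R) (a : R) : (K.map C).map (evalRingHom a) = K := by
  rw [Ideal.map_map, show (evalRingHom a).comp C = RingHom.id R from RingHom.ext fun r => by simp,
    Ideal.map_id]

lemma exists_forall₂_sub_mem {I : Ideal R} {x : R} {l : List R}
    (h : ofList l ≤ I ⊔ span {x}) :
    ∃ l', ofList l' ≤ I ∧ List.Forall₂ (fun a b => a - b ∈ span {x}) l l' := by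
  induction l with
  | nil => exact ⟨[], by simp, .nil⟩
  | cons a l ih =>
    rw [ofList_cons, sup_le_iff, span_singleton_le_iff_mem] at h
    obtain ⟨l', hl', hll'⟩ := ih h.2
    obtain ⟨t, ht⟩ := mem_sup_span_iff.1 h.1
    refine ⟨(a - x * t) :: l', ?_, .cons ?_ hll'⟩
    · rw [ofList_cons, sup_le_iff, span_singleton_le_iff_mem]
      exact ⟨ht, hl'⟩
    · rw [sub_sub_cancel]
      exact mul_mem_right _ _ (mem_span_singleton_self x)

variable [IsLocalRing R] [IsNoetherianRing R]

lemma flatAt_map_C (K : Ideal R) : FlatAt (K.map C) 0 := by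
  refine RegOn.localize _ fun f hf => ?_
  rw [mem_map_C_iff] at hf ⊢
  intro n
  have := hf (n + 1)
  rwa [C_0, sub_zero, coeff_X_mul] at this

variable {d : ℕ} [Infinite (ResidueField R)]

lemma GorLocal.le_of_linkedInSteps_sup_span (hG : GorLocal R d) {I₀ L : Ideal R}
    (hmax : MaximalInLinkageClass R I₀) (hI₀L : I₀ ≤ L) (hL : ¬ maximalIdeal R ≤ L) {n : ℕ}
    (hn : n + 1 < d) (k : ℕ) {I : Ideal R} {x : R} (hI : InSameLinkageClass R I₀ I)
    (hCM : CMQuot I (n + 1)) (hxm : x ∈ maximalIdeal R) (hxI : RegOn I x)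
    (hIL : I₀ ⊔ span {x} = L) {J : Ideal R} (hJ : LinkedInSteps R k (I ⊔ span {x}) J) :
    J ≤ L := by
  induction k using Nat.strong_induction_on generalizing I x J with
  | _ k ih =>
  rcases k with _ | k
  · obtain rfl : _ = J := hJ
    exact hIL ▸ sup_le_sup_right (hmax I hI) _
  obtain ⟨J₁, hlink, hJ⟩ := hJ
  obtain ⟨_, hn', hK⟩ := hCM.sup_span hxI hxm
  obtain rfl := Nat.succ.inj hn'
  obtain ⟨l, hl, hlm, hlK, h1, h2⟩ := exists_of_isDirectlyLinked hlink
  have hlen := hG.length_eq hl hlm hlK hK (by rw [h2, h1])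
  obtain ⟨hP, -, hCMJ⟩ := hG.duality hl hlm hlK hK hlen
  obtain _ | ⟨a₀, l⟩ := l
  · rw [List.length_nil] at hlen
    omega
  have ha₀ : a₀ ∈ I ⊔ span {x} := hlK (mem_ofList (by simp))
  obtain ⟨a, hi⟩ := mem_sup_span_iff.1 ha₀
  set i := a₀ - x * a with hi_def
  let f : List R[X] := (C a₀ + X * C x) :: l.map C
  have hf : ∀ b, f.map (eval b) = (a₀ + b * x) :: l := fun b => by
    simpa [f, Function.comp_def] using mul_comm x b
  have hfK : ofList f ≤ (I ⊔ span {x}).map C := by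
    refine ofList_le.2 (List.forall_mem_cons.2 ⟨?_, List.forall_mem_map.2 fun b hb => ?_⟩)
    · exact add_mem (mem_map_of_mem C ha₀) (Ideal.mul_mem_left _ _
        (mem_map_of_mem C (mem_sup_right (mem_span_singleton_self x))))
    · exact mem_map_of_mem C (hlK (mem_ofList (by simp [hb])))
  have hfm : ∀ b, ∀ g ∈ f, g.eval b ∈ maximalIdeal R := fun b =>
    eval_mem_maximalIdeal (by rw [map_C_map_evalRingHom]; exact hK.ne_top) hfK
  have hf0 : f.map (eval 0) = a₀ :: l := by rw [hf, zero_mul, add_zero]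
  obtain ⟨hflat, hmap⟩ := (flatAt_map_C (I ⊔ span {x})).colon hfK (hfm 0) (by rwa [hf0])
    (by rwa [hf0, map_C_map_evalRingHom])
  rw [hf0, map_C_map_evalRingHom, h2] at hmap
  have key : ∀ᶠ b in almostAll R, ∃ I₁ y, InSameLinkageClass R I₀ I₁ ∧ CMQuot I₁ (n + 1) ∧
      y ∈ maximalIdeal R ∧ RegOn I₁ y ∧ I₀ ⊔ span {y} = L ∧
      (Submodule.colon (ofList f) ((I ⊔ span {x}).map C : Set R[X])).map (evalRingHom b) =
        I₁ ⊔ span {y} := by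
    filter_upwards [eventually_isUnit_sub (-a), eventually_flatAt ((I ⊔ span {x}).map C),
      eventually_regSeq_eval (hfm 0) (by rwa [hf0])] with b hu hflat hreg
    replace hreg := hreg (hfm b)
    have hle := ofList_map_eval_le b hfK
    have hfm' : ∀ c ∈ f.map (eval b), c ∈ maximalIdeal R := List.forall_mem_map.2 (hfm b)
    have hlen' : n + (f.map (eval b)).length = d := by
      rw [hf, List.length_cons]
      rwa [List.length_cons] at hlen
    rw [map_C_map_evalRingHom] at hle
    have hmap := (hflat.colon hfK (hfm b) hreg
      (by rw [map_C_map_evalRingHom]; exact (hG.duality hreg hfm' hle hK hlen').1)).2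
    rw [map_C_map_evalRingHom, hf] at hmap
    rw [hf] at hreg hfm'
    obtain ⟨u, hu⟩ := hu
    set y := x + ↑u⁻¹ * i with hy
    have huy : a₀ + b * x = u * y := by
      rw [hy, mul_add, Units.mul_inv_cancel_left, hu, hi_def]
      ring
    have hxy : x - y ∈ I := by
      rw [hy, sub_add_cancel_left]
      exact I.neg_mem (I.mul_mem_left _ hi)
    have hyI : RegOn I y := hxI.congr hxy
    have hym : y ∈ maximalIdeal R :=
      add_mem hxm (Ideal.mul_mem_left _ _ (le_maximalIdeal hCM.ne_top hi))
    rw [huy] at hreg hmap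
    have hspan : span {(u : R) * y} = span {y} := span_singleton_mul_left_unit u.isUnit y
    obtain ⟨l', hl'I, hll'⟩ := exists_forall₂_sub_mem (x := y) (l := l) (I := I) (by
      rw [← sup_span_singleton_congr hxy]
      exact fun c hc => hlK (by rw [ofList_cons]; exact mem_sup_right hc))
    have hl'm : ∀ c ∈ l', c ∈ maximalIdeal R :=
      ofList_le.1 (hl'I.trans (le_maximalIdeal hCM.ne_top))
    have hyl' : RegSeq ⊥ (y :: l') :=
      ⟨hreg.1.of_mul_unit, by
        have := hreg.2
        rw [bot_sup_eq, hspan] at this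
        rw [bot_sup_eq]
        exact this.congr hll'⟩
    obtain ⟨hl', hyreg⟩ := (regSeq_append _ _ _).1 (hyl'.perm (l' := l' ++ [y])
      (List.perm_append_singleton y l').symm (List.forall_mem_cons.2 ⟨hym, hl'm⟩))
    replace hyreg : RegOn (ofList l') y := by simpa using hyreg.1
    have hlen'' : n + 1 + l'.length = d := by
      rw [← hll'.length_eq]
      rw [List.length_cons] at hlen
      omega
    have hI' : ofList ((u : R) * y :: l) = ofList l' ⊔ span {y} := by
      rw [ofList_cons, hspan, sup_ofList_congr hll', sup_comm]
    have hcolon : Submodule.colon (ofList ((u : R) * y :: l)) (I ⊔ span {x} : Ideal R) =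
        Submodule.colon (ofList l') (I : Set R) ⊔ span {y} := by
      rw [hI', sup_span_singleton_congr hxy,
        (hG.duality hl' hl'm hl'I hCM hlen'').1.colon_sup_span hl'I hyreg]
    have hne : Submodule.colon (ofList l') (I : Set R) ≠ ⊤ := by
      intro htop
      have hIl := eq_of_colon_eq_top hl'I htop
      refine hL (maximalIdeal_le_of_ofList (l := l') ?_ hl' hl'm fun J' hJ' => ?_)
      · rintro rfl
        rw [List.length_nil] at hlen''
        omega
      · exact (hmax J' (hI.trans _ _ _ (.rel _ _ (hIl ▸ hJ')))).trans hI₀L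
    refine ⟨_, y, hI.trans _ _ _ (.rel _ _ (hG.isDirectlyLinked hl' hl'm hl'I hCM hlen'' hne)),
      (hG.duality hl' hl'm hl'I hCM hlen'').2.2 hne, hym, hyreg.colon _, ?_,
      hmap.trans hcolon⟩
    rw [← hIL, sup_span_singleton_congr (hmax I hI hxy)]
  refine hG.le_of_eventually_le hL (n.lt_succ_self.trans hn) k hflat ?_ ?_ ?_ (by rwa [hmap])
  · rw [hmap, ← h2]
    exact hCMJ (h2 ▸ hlink.2.1)
  · filter_upwards [key] with b ⟨I₁, y, _, hCM₁, hym, hyI₁, _, hb⟩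
    obtain ⟨_, hn', h⟩ := hCM₁.sup_span hyI₁ hym
    rw [hb, Nat.succ.inj hn']
    exact h
  · filter_upwards [key] with b ⟨I₁, y, hI₁, hCM₁, hym, hyI₁, hyL, hb⟩ j hj J' hJ'
    rw [hb] at hJ'
    exact ih j (Nat.lt_succ_of_le hj) hI₁ hCM₁ hym hyI₁ hyL hJ'

lemma GorLocal.maximalInLinkageClass_sup_span (hG : GorLocal R d) {I : Ideal R} {n : ℕ}
    (hI : CMQuot I n) {z : R} (hzI : z ∈ I) (hz : RegOn ⊥ z) {x : R} (hxm : x ∈ maximalIdeal R)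
    (hx : RegOn I x) (hmax : MaximalInLinkageClass R I) :
    MaximalInLinkageClass R (I ⊔ span {x}) := by
  intro J hJ
  obtain ⟨k, hk⟩ := exists_linkedInSteps hJ
  obtain ⟨n, rfl, hK⟩ := hI.sup_span hx hxm
  by_cases hm : maximalIdeal R ≤ I ⊔ span {x}
  · exact (le_maximalIdeal (ne_top_of_linkedInSteps hK.ne_top hk)).trans hm
  refine hG.le_of_linkedInSteps_sup_span hmax le_sup_left hm ?_ k (.refl I) hI hxm hx rfl hk
  obtain ⟨e, rfl, he⟩ := hG.cm.sup_span hz (le_maximalIdeal hI.ne_top hzI)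
  have := ringKrullDim_le_of_surjective _ (Ideal.Quotient.factor_surjective
    (show ⊥ ⊔ span {z} ≤ I by simpa using hzI))
  rw [hI.dim, he.dim] at this
  have : n + 1 ≤ e := by exact_mod_cast this
  omega

lemma GorLocal.maximalInLinkageClass_sup_ofList (hG : GorLocal R d) {I : Ideal R} {n : ℕ}
    (hI : CMQuot I n) {z : R} (hzI : z ∈ I) (hz : RegOn ⊥ z) {l : List R}
    (hlm : ∀ a ∈ l, a ∈ maximalIdeal R) (hl : RegSeq I l) (hmax : MaximalInLinkageClass R I) :
    MaximalInLinkageClass R (I ⊔ ofList l) := by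
  induction l generalizing I n with
  | nil => simpa using hmax
  | cons x l ih =>
    obtain ⟨hxm, hlm⟩ := List.forall_mem_cons.1 hlm
    obtain ⟨n', -, hI'⟩ := hI.sup_span hl.1 hxm
    rw [ofList_cons, ← sup_assoc]
    exact ih hI' (mem_sup_left hzI) hlm hl.2
      (hG.maximalInLinkageClass_sup_span hI hzI hz hxm hl.1 hmax)

end

end Linkage

/-- Corollary 3.3. Let `I` be a Cohen-Macaulay ideal of positive grade
in a Noetherian local Gorenstein ring with infinite residue field and let `x₁,…,x_r` be a
sequence regular on `R` and on `R/I`. If `I` is maximal in its linkage class then so is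
`I + (x₁,…,x_r)`. -/
theorem statement11 (R : Type) [CommRing R] [IsLocalRing R] [IsNoetherianRing R]
    (hGor : IsGorensteinLocalRing R) (hres : Infinite (IsLocalRing.ResidueField R))
    (I : Ideal R) (hCM : IsCMIdeal R I) (hgrade : ∃ r ∈ I, r ∈ nonZeroDivisors R)
    (xs : List R) (hxs : RingTheory.Sequence.IsRegular R xs)
    (hxsI : RingTheory.Sequence.IsRegular (R ⧸ I) xs)
    (hmax : MaximalInLinkageClass R I) :
    MaximalInLinkageClass R (I ⊔ Ideal.ofList xs) := by
  obtain ⟨d, hG⟩ := Linkage.exists_gorLocal hGor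
  obtain ⟨n, hI⟩ := Linkage.exists_cmQuot_of_isCMIdeal hCM
  obtain ⟨z, hzI, hz⟩ := hgrade
  refine hG.maximalInLinkageClass_sup_ofList hI hzI (fun r hr => ?_)
    (Linkage.ofList_le.1 (le_maximalIdeal ((Linkage.isRegular_iff_regSeq xs).1 hxs).2))
    ((Linkage.isRegular_quotient_iff I xs).1 hxsI).1 hmax
  rw [Ideal.mem_bot] at hr ⊢
  exact (mul_left_mem_nonZeroDivisors_eq_zero_iff hz).1 hr
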